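/- Cavity estimate, second part: ∫_0^{ε₀} | E[log⟨exp(y(x))⟩_{n,ε}] − (λ/4)·E[Q²] | dε → 0 as n → ∞. -/

import Mathlib

open MeasureTheory ProbabilityTheory Filter Finset Real

noncomputable section

/-- The standard Gaussian measure on `ℝ`. -/
def stdGauss : Measure ℝ := gaussianReal 0 1

/-- The Bernoulli(ε) measure on `Bool`. -/
def bern (ε : ℝ) : Measure Bool :=
  ENNReal.ofReal ε • Measure.dirac true + ENNReal.ofReal (1 - ε) • Measure.dirac false

instance (ε : ℝ) : IsFiniteMeasure (bern ε) := by
  constructor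
  rw [bern, Measure.add_apply, Measure.smul_apply, Measure.smul_apply, smul_eq_mul,
    smul_eq_mul, measure_univ, measure_univ, mul_one, mul_one]
  exact ENNReal.add_lt_top.2 ⟨ENNReal.ofReal_lt_top, ENNReal.ofReal_lt_top⟩

/-- The set of pairs `(i, j)` with `i < j`. -/
def pairs (n : ℕ) : Finset (Fin n × Fin n) :=
  Finset.univ.filter fun p => p.1 < p.2

/-- The ambient sample space of the cavity computation:
`(X, Z, L, Z″, Z̃)` where `X : Fin (n+1) → ℝ` is the signal, `Z` the Gaussian noise,
`L` the Bernoulli revelation variables, and `Z″, Z̃` the auxiliary Gaussians used in `y`. -/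
abbrev CavΩ (n : ℕ) :=
  (Fin (n + 1) → ℝ) × ((Fin (n + 1) × Fin (n + 1)) → ℝ) × (Fin (n + 1) → Bool) ×
    (Fin (n + 1) → ℝ) × ((Fin (n + 1) × Fin (n + 1)) → ℝ)

/-- The law of `(X, Z, L, Z″, Z̃)`: all coordinates independent, `X_i` i.i.d. `P0`,
`Z, Z″, Z̃` i.i.d. standard Gaussian, `L_i` i.i.d. Bernoulli(ε). -/
def cavMeas (P0 : Measure ℝ) [IsProbabilityMeasure P0] (n : ℕ) (ε : ℝ) :
    Measure (CavΩ n) :=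
  (Measure.pi fun _ : Fin (n + 1) => P0).prod
    ((Measure.pi fun _ : Fin (n + 1) × Fin (n + 1) => stdGauss).prod
      ((Measure.pi fun _ : Fin (n + 1) => bern ε).prod
        ((Measure.pi fun _ : Fin (n + 1) => stdGauss).prod
          (Measure.pi fun _ : Fin (n + 1) × Fin (n + 1) => stdGauss))))

/-- `x̄_i = L_i X_i + (1 − L_i) x_i`. -/
def xbar (n : ℕ) (ω : CavΩ n) (x : Fin n → ℝ) : Fin n → ℝ :=
  fun i => if ω.2.2.1 i.castSucc then ω.1 i.castSucc else x i

/-- `σ̄ = (1 − L_{n+1}) σ + L_{n+1} X′`. -/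
def sigbar (n : ℕ) (ω : CavΩ n) (σ : ℝ) : ℝ :=
  if ω.2.2.1 (Fin.last n) then ω.1 (Fin.last n) else σ

/-- The cavity Hamiltonian `H′_n(x)`. -/
def Hcav (n : ℕ) (lam : ℝ) (ω : CavΩ n) (x : Fin n → ℝ) : ℝ :=
  ∑ p ∈ pairs n,
    (Real.sqrt (lam / (n + 1)) * ω.2.1 (p.1.castSucc, p.2.castSucc) * x p.1 * x p.2
      + lam / (n + 1) * ω.1 p.1.castSucc * ω.1 p.2.castSucc * x p.1 * x p.2
      - lam / (2 * (n + 1)) * (x p.1) ^ 2 * (x p.2) ^ 2)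

/-- The configurations `x ∈ Sⁿ`. -/
def confs (S : Finset ℝ) (n : ℕ) : Finset (Fin n → ℝ) :=
  Fintype.piFinset fun _ => S

/-- The weight `P0⊗n(x) = Π_i P0({x_i})`. -/
def weight (P0 : Measure ℝ) (n : ℕ) (x : Fin n → ℝ) : ℝ :=
  ∏ i, (P0 {x i}).toReal

/-- The Gibbs average
`⟨f(x)⟩_{n,ε} = Σ_x P0⊗n(x) f(x̄) exp(H′_n(x̄)) / Σ_x P0⊗n(x) exp(H′_n(x̄))`. -/
def gibbs (P0 : Measure ℝ) (S : Finset ℝ) (n : ℕ) (lam : ℝ) (ω : CavΩ n)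
    (f : (Fin n → ℝ) → ℝ) : ℝ :=
  (∑ x ∈ confs S n, weight P0 n x * f (xbar n ω x) * Real.exp (Hcav n lam ω (xbar n ω x)))
    / (∑ x ∈ confs S n, weight P0 n x * Real.exp (Hcav n lam ω (xbar n ω x)))

/-- The normalized dot product `u · v = (1/n) Σ_i u_i v_i`. -/
def ndot (n : ℕ) (u v : Fin n → ℝ) : ℝ := (1 / n : ℝ) * ∑ i, u i * v i

/-- The cavity field `z(x) = √(λ/n) Σ_i x_i Z′_i + λ (x·X) X′`. -/
def zfield (n : ℕ) (lam : ℝ) (ω : CavΩ n) (x : Fin n → ℝ) : ℝ :=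
  Real.sqrt (lam / n) * ∑ i : Fin n, x i * ω.2.1 (i.castSucc, Fin.last n)
    + lam * ndot n x (fun i => ω.1 i.castSucc) * ω.1 (Fin.last n)

/-- The cavity field `s(x) = −(λ/2) (x·x)`. -/
def sfield (n : ℕ) (lam : ℝ) (x : Fin n → ℝ) : ℝ := -(lam / 2) * ndot n x x

/-- `b_i = ⟨x_i⟩_{n,ε}`. -/
def bcoef (P0 : Measure ℝ) (S : Finset ℝ) (n : ℕ) (lam : ℝ) (ω : CavΩ n)
    (i : Fin n) : ℝ :=
  gibbs P0 S n lam ω (fun x => x i)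

/-- `Q = (1/n) Σ_i b_i²`. -/
def Qoverlap (P0 : Measure ℝ) (S : Finset ℝ) (n : ℕ) (lam : ℝ) (ω : CavΩ n) : ℝ :=
  (1 / n : ℝ) * ∑ i : Fin n, (bcoef P0 S n lam ω i) ^ 2

/-- The cavity field
`y(x) = (√λ/(√2 n)) Σ_i Z″_i x_i² + (√λ/n) Σ_{i<j} x_i x_j Z̃_{ij}
  + (λ/2)((x·X)² − (1/2)(x·x)²)`. -/
def yfield (n : ℕ) (lam : ℝ) (ω : CavΩ n) (x : Fin n → ℝ) : ℝ :=
  Real.sqrt lam / (Real.sqrt 2 * n) * ∑ i : Fin n, ω.2.2.2.1 i.castSucc * (x i) ^ 2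
    + Real.sqrt lam / n *
        ∑ p ∈ pairs n, x p.1 * x p.2 * ω.2.2.2.2 (p.1.castSucc, p.2.castSucc)
    + lam / 2 * ((ndot n x (fun i => ω.1 i.castSucc)) ^ 2 - 1 / 2 * (ndot n x x) ^ 2)

/-- The function `x ↦ Σ_{σ∈S} P0(σ) exp(σ̄ z(x) + σ̄² s(x))`. -/
def fzs (P0 : Measure ℝ) (S : Finset ℝ) (n : ℕ) (lam : ℝ) (ω : CavΩ n)
    (x : Fin n → ℝ) : ℝ :=
  ∑ σ ∈ S, (P0 {σ}).toReal *
    Real.exp (sigbar n ω σ * zfield n lam ω x + (sigbar n ω σ) ^ 2 * sfield n lam x)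

/-- `U = ⟨Σ_{σ∈S} P0(σ) exp(σ̄ z(x) + σ̄² s(x))⟩_{n,ε}`. -/
def Ucav (P0 : Measure ℝ) (S : Finset ℝ) (n : ℕ) (lam : ℝ) (ω : CavΩ n) : ℝ :=
  gibbs P0 S n lam ω (fzs P0 S n lam ω)

/-- `V = Σ_{σ∈S} P0(σ) exp(σ̄ √(λ/n) Σ_i b_i Z′_i + λQ X′ σ̄ − (λQ/2) σ̄²)`. -/
def Vcav (P0 : Measure ℝ) (S : Finset ℝ) (n : ℕ) (lam : ℝ) (ω : CavΩ n) : ℝ :=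
  ∑ σ ∈ S, (P0 {σ}).toReal *
    Real.exp (sigbar n ω σ * Real.sqrt (lam / n) *
        (∑ i : Fin n, bcoef P0 S n lam ω i * ω.2.1 (i.castSucc, Fin.last n))
      + lam * Qoverlap P0 S n lam ω * ω.1 (Fin.last n) * sigbar n ω σ
      - lam * Qoverlap P0 S n lam ω / 2 * (sigbar n ω σ) ^ 2)

/-- The configuration agreeing with `X` where `ℓ` is true and with `x` elsewhere. -/
def mix {n : ℕ} (ℓ : Fin n → Bool) (X x : Fin n → ℝ) : Fin n → ℝ :=
  fun i => if ℓ i then X i else x i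

lemma mix_mem {n : ℕ} {S : Finset ℝ} (ℓ : Fin n → Bool) {X x : Fin n → ℝ}
    (hX : X ∈ confs S n) (hx : x ∈ confs S n) : mix ℓ X x ∈ confs S n := by
  simp only [confs, Fintype.mem_piFinset, mix] at *
  intro i
  split_ifs
  · exact hX i
  · exact hx i

lemma mix_mix_swap {n : ℕ} (ℓ : Fin n → Bool) (X x : Fin n → ℝ) :
    mix ℓ (mix ℓ X x) (mix ℓ x X) = X := by
  ext i; simp only [mix]; split_ifs <;> rfl

lemma mix_mix_left {n : ℕ} {ℓ ℓ' : Fin n → Bool} (hℓ : ∀ i, ℓ i = true → ℓ' i = true)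
    (X x z : Fin n → ℝ) : mix ℓ (mix ℓ' X x) z = mix ℓ X z := by
  ext i
  simp only [mix]
  split_ifs with h1 h2
  · rfl
  · exact absurd (hℓ i h1) h2
  · rfl

/-- Product weight of a configuration. -/
def prodWeight {n : ℕ} (p : ℝ → ℝ) (x : Fin n → ℝ) : ℝ := ∏ i, p (x i)

lemma prodWeight_nonneg {n : ℕ} {p : ℝ → ℝ} (hp : ∀ s, 0 ≤ p s) (x : Fin n → ℝ) :
    0 ≤ prodWeight p x := prod_nonneg fun _ _ => hp _

lemma prodWeight_mix_mul {n : ℕ} (p : ℝ → ℝ) (ℓ : Fin n → Bool) (X x : Fin n → ℝ) :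
    prodWeight p (mix ℓ X x) * prodWeight p (mix ℓ x X) = prodWeight p X * prodWeight p x := by
  simp only [prodWeight, ← prod_mul_distrib, mix]
  refine prod_congr rfl fun i _ => ?_
  split_ifs
  · rfl
  · exact mul_comm _ _

lemma sum_prodWeight {n : ℕ} {p : ℝ → ℝ} {S : Finset ℝ} (hS : ∑ s ∈ S, p s = 1) :
    ∑ x ∈ confs S n, prodWeight p x = 1 := by
  have := (Finset.prod_univ_sum (fun _ : Fin n => S) (fun _ s => p s)).symm
  simpa [hS, confs, prodWeight] using this

/-- Normalization of the law with density `h`, conditioned on the coordinates revealed by `ℓ`. -/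
def condNorm {n : ℕ} (p : ℝ → ℝ) (S : Finset ℝ) (h : (Fin n → ℝ) → ℝ) (ℓ : Fin n → Bool)
    (X : Fin n → ℝ) : ℝ :=
  ∑ x ∈ confs S n, prodWeight p x * h (mix ℓ X x)

/-- Average under the law with density `h` with respect to the product weight, conditioned on the
coordinates of `X` revealed by `ℓ`. -/
def condAvg {n : ℕ} (p : ℝ → ℝ) (S : Finset ℝ) (h : (Fin n → ℝ) → ℝ) (ℓ : Fin n → Bool)
    (X : Fin n → ℝ) (f : (Fin n → ℝ) → ℝ) : ℝ :=
  ∑ x ∈ confs S n, prodWeight p x * h (mix ℓ X x) / condNorm p S h ℓ X * f (mix ℓ X x)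

section condAvg

variable {n : ℕ} {p : ℝ → ℝ} {S : Finset ℝ} {h : (Fin n → ℝ) → ℝ} {ℓ ℓ' : Fin n → Bool}
  {X : Fin n → ℝ}

lemma condNorm_pos (hp : ∀ s, 0 ≤ p s) (hS : ∑ s ∈ S, p s = 1) (hh : ∀ u, 0 < h u)
    (ℓ : Fin n → Bool) (X : Fin n → ℝ) : 0 < condNorm p S h ℓ X := by
  have h0 : ∀ x ∈ confs S n, 0 ≤ prodWeight p x * h (mix ℓ X x) := fun x _ =>
    mul_nonneg (prodWeight_nonneg hp x) (hh _).le
  refine lt_of_le_of_ne (sum_nonneg h0) fun h1 => ?_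
  have h2 := (sum_eq_zero_iff_of_nonneg h0).1 h1.symm
  have h3 : ∑ x ∈ confs S n, prodWeight p x = 0 := sum_eq_zero fun x hx =>
    (mul_eq_zero.1 (h2 x hx)).resolve_right (hh _).ne'
  rw [sum_prodWeight hS] at h3
  exact one_ne_zero h3

lemma condNorm_mix (hℓ : ∀ i, ℓ i = true → ℓ' i = true) (X x : Fin n → ℝ) :
    condNorm p S h ℓ (mix ℓ' X x) = condNorm p S h ℓ X := by
  simp only [condNorm, mix_mix_left hℓ]

lemma condAvg_mix (hℓ : ∀ i, ℓ i = true → ℓ' i = true) (X x : Fin n → ℝ)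
    (f : (Fin n → ℝ) → ℝ) : condAvg p S h ℓ (mix ℓ' X x) f = condAvg p S h ℓ X f := by
  simp only [condAvg, mix_mix_left hℓ, condNorm_mix hℓ]

lemma condWeight_nonneg (hp : ∀ s, 0 ≤ p s) (hS : ∑ s ∈ S, p s = 1) (hh : ∀ u, 0 < h u)
    (x : Fin n → ℝ) : 0 ≤ prodWeight p x * h (mix ℓ X x) / condNorm p S h ℓ X :=
  div_nonneg (mul_nonneg (prodWeight_nonneg hp x) (hh _).le) (condNorm_pos hp hS hh ℓ X).le

lemma sum_condWeight (hp : ∀ s, 0 ≤ p s) (hS : ∑ s ∈ S, p s = 1) (hh : ∀ u, 0 < h u) :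
    ∑ x ∈ confs S n, prodWeight p x * h (mix ℓ X x) / condNorm p S h ℓ X = 1 := by
  rw [← sum_div]
  exact div_self (condNorm_pos hp hS hh ℓ X).ne'

lemma condAvg_const (hp : ∀ s, 0 ≤ p s) (hS : ∑ s ∈ S, p s = 1) (hh : ∀ u, 0 < h u) (c : ℝ) :
    condAvg p S h ℓ X (fun _ => c) = c := by
  rw [condAvg, ← sum_mul, sum_condWeight hp hS hh, one_mul]

lemma condAvg_add (f g : (Fin n → ℝ) → ℝ) :
    condAvg p S h ℓ X (fun u => f u + g u) = condAvg p S h ℓ X f + condAvg p S h ℓ X g := by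
  simp only [condAvg, mul_add, sum_add_distrib]

lemma condAvg_sub (f g : (Fin n → ℝ) → ℝ) :
    condAvg p S h ℓ X (fun u => f u - g u) = condAvg p S h ℓ X f - condAvg p S h ℓ X g := by
  simp only [condAvg, mul_sub, sum_sub_distrib]

lemma condAvg_const_mul (c : ℝ) (f : (Fin n → ℝ) → ℝ) :
    condAvg p S h ℓ X (fun u => c * f u) = c * condAvg p S h ℓ X f := by
  simp only [condAvg, mul_sum]
  exact sum_congr rfl fun x _ => by ring

lemma condAvg_sum {α : Type*} (s : Finset α) (f : α → (Fin n → ℝ) → ℝ) :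
    condAvg p S h ℓ X (fun u => ∑ a ∈ s, f a u) = ∑ a ∈ s, condAvg p S h ℓ X (f a) := by
  simp only [condAvg, mul_sum]
  exact sum_comm

lemma condAvg_mono (hp : ∀ s, 0 ≤ p s) (hS : ∑ s ∈ S, p s = 1) (hh : ∀ u, 0 < h u)
    (hX : X ∈ confs S n) {f g : (Fin n → ℝ) → ℝ} (hfg : ∀ u ∈ confs S n, f u ≤ g u) :
    condAvg p S h ℓ X f ≤ condAvg p S h ℓ X g :=
  sum_le_sum fun x hx => mul_le_mul_of_nonneg_left (hfg _ (mix_mem ℓ hX hx))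
    (condWeight_nonneg hp hS hh x)

lemma abs_condAvg_le (hp : ∀ s, 0 ≤ p s) (hS : ∑ s ∈ S, p s = 1) (hh : ∀ u, 0 < h u)
    (hX : X ∈ confs S n) {f : (Fin n → ℝ) → ℝ} {M : ℝ} (hf : ∀ u ∈ confs S n, |f u| ≤ M) :
    |condAvg p S h ℓ X f| ≤ M := by
  refine abs_le.2 ⟨?_, ?_⟩
  · rw [← condAvg_const (ℓ := ℓ) (X := X) hp hS hh (-M)]
    exact condAvg_mono hp hS hh hX fun u hu => (abs_le.1 (hf u hu)).1
  · rw [← condAvg_const (ℓ := ℓ) (X := X) hp hS hh M]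
    exact condAvg_mono hp hS hh hX fun u hu => (abs_le.1 (hf u hu)).2

/-- Tower property of `condAvg`. -/
lemma sum_condAvg (hp : ∀ s, 0 ≤ p s) (hS : ∑ s ∈ S, p s = 1) (hh : ∀ u, 0 < h u)
    (F : (Fin n → ℝ) → (Fin n → ℝ) → ℝ) (hF : ∀ u X x, F u (mix ℓ X x) = F u X) :
    ∑ X ∈ confs S n, prodWeight p X * h X * condAvg p S h ℓ X (fun u => F u X) =
      ∑ X ∈ confs S n, prodWeight p X * h X * F X X := by
  have h1 : ∑ X ∈ confs S n, prodWeight p X * h X * condAvg p S h ℓ X (fun u => F u X) =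
      ∑ q ∈ confs S n ×ˢ confs S n, prodWeight p q.1 * h q.1 *
        (prodWeight p q.2 * h (mix ℓ q.1 q.2) / condNorm p S h ℓ q.1 *
          F (mix ℓ q.1 q.2) q.1) := by
    rw [sum_product]
    exact sum_congr rfl fun X _ => by rw [condAvg, mul_sum]
  have h2 : ∑ X ∈ confs S n, prodWeight p X * h X * F X X =
      ∑ q ∈ confs S n ×ˢ confs S n, prodWeight p q.1 * h q.1 *
        (prodWeight p q.2 * h (mix ℓ q.1 q.2) / condNorm p S h ℓ q.1 * F q.1 q.1) := by
    rw [sum_product]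
    refine sum_congr rfl fun X _ => ?_
    simp only [← mul_sum, ← sum_mul, sum_condWeight hp hS hh, one_mul]
  rw [h1, h2]
  refine sum_nbij' (fun q => (mix ℓ q.1 q.2, mix ℓ q.2 q.1))
    (fun q => (mix ℓ q.1 q.2, mix ℓ q.2 q.1)) ?_ ?_ ?_ ?_ ?_
  · rintro ⟨X, x⟩ hq
    rw [mem_product] at hq ⊢
    exact ⟨mix_mem ℓ hq.1 hq.2, mix_mem ℓ hq.2 hq.1⟩
  · rintro ⟨X, x⟩ hq
    rw [mem_product] at hq ⊢
    exact ⟨mix_mem ℓ hq.1 hq.2, mix_mem ℓ hq.2 hq.1⟩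
  · rintro ⟨X, x⟩ _
    simp only [mix_mix_swap]
  · rintro ⟨X, x⟩ _
    simp only [mix_mix_swap]
  · rintro ⟨X, x⟩ _
    simp only [mix_mix_swap, condNorm_mix (ℓ := ℓ) (ℓ' := ℓ) (fun _ => id), hF]
    linear_combination (-(h X * h (mix ℓ X x) / condNorm p S h ℓ X *
      F (mix ℓ X x) X)) * prodWeight_mix_mul p ℓ X x

/-- Conditional covariance of two coordinates. -/
def condCov (p : ℝ → ℝ) (S : Finset ℝ) (h : (Fin n → ℝ) → ℝ) (ℓ : Fin n → Bool)
    (X : Fin n → ℝ) (i j : Fin n) : ℝ :=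
  condAvg p S h ℓ X (fun u => u i * u j) -
    condAvg p S h ℓ X (fun u => u i) * condAvg p S h ℓ X (fun u => u j)

lemma condAvg_sq_residual (hp : ∀ s, 0 ≤ p s) (hS : ∑ s ∈ S, p s = 1) (hh : ∀ u, 0 < h u)
    (i j : Fin n) (t : ℝ) :
    condAvg p S h ℓ X (fun u => (u i - condAvg p S h ℓ X (fun u => u i)
      - t * (u j - condAvg p S h ℓ X (fun u => u j))) ^ 2) =
    condCov p S h ℓ X i i - 2 * t * condCov p S h ℓ X i j + t ^ 2 * condCov p S h ℓ X j j := by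
  set a := condAvg p S h ℓ X (fun u => u i) with ha
  set b := condAvg p S h ℓ X (fun u => u j) with hb
  have : (fun u : Fin n → ℝ => (u i - a - t * (u j - b)) ^ 2) = fun u =>
      (((u i * u i + (-(2 * t)) * (u i * u j)) + t ^ 2 * (u j * u j))
        + ((2 * (t * b - a)) * u i + (2 * t * a - 2 * t ^ 2 * b) * u j)) + (a - t * b) ^ 2 := by
    ext u; ring
  rw [this]
  simp only [condAvg_add, condAvg_const_mul, condAvg_const hp hS hh, condCov, ← ha, ← hb]
  ring

lemma condAvg_sq_sub (hp : ∀ s, 0 ≤ p s) (hS : ∑ s ∈ S, p s = 1) (hh : ∀ u, 0 < h u)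
    (i : Fin n) (P : ℝ) :
    condAvg p S h ℓ X (fun u => (u i - P) ^ 2) =
      condCov p S h ℓ X i i + (condAvg p S h ℓ X (fun u => u i) - P) ^ 2 := by
  set a := condAvg p S h ℓ X (fun u => u i) with ha
  have : (fun u : Fin n → ℝ => (u i - P) ^ 2) = fun u =>
      (u i * u i + (-(2 * P)) * u i) + P ^ 2 := by
    ext u; ring
  rw [this]
  simp only [condAvg_add, condAvg_const_mul, condAvg_const hp hS hh, condCov, ← ha]
  ring

lemma condCov_self_nonneg (hp : ∀ s, 0 ≤ p s) (hS : ∑ s ∈ S, p s = 1) (hh : ∀ u, 0 < h u)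
    (i : Fin n) : 0 ≤ condCov p S h ℓ X i i := by
  have := condAvg_sq_sub (ℓ := ℓ) (X := X) hp hS hh i (condAvg p S h ℓ X (fun u => u i))
  rw [sub_self, zero_pow two_ne_zero, add_zero] at this
  rw [← this]
  exact sum_nonneg fun x _ => mul_nonneg (condWeight_nonneg hp hS hh x) (sq_nonneg _)

lemma condCov_self_le (hp : ∀ s, 0 ≤ p s) (hS : ∑ s ∈ S, p s = 1) (hh : ∀ u, 0 < h u)
    {K : ℝ} (hSK : ∀ s ∈ S, |s| ≤ K) (hX : X ∈ confs S n) (i : Fin n) :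
    condCov p S h ℓ X i i ≤ K ^ 2 := by
  have h1 : |condAvg p S h ℓ X (fun u => u i * u i)| ≤ K ^ 2 :=
    abs_condAvg_le hp hS hh hX fun u hu => by
      have h2 := hSK _ (Fintype.mem_piFinset.1 hu i)
      rw [abs_mul, sq]
      exact mul_le_mul h2 h2 (abs_nonneg _) ((abs_nonneg _).trans h2)
  have h3 := (abs_le.1 h1).2
  rw [condCov]
  nlinarith [mul_self_nonneg (condAvg p S h ℓ X (fun u => u i))]

/-- Revealing coordinate `j` decreases the mean conditional variance of coordinate `i` by at least
the mean squared conditional covariance, up to the a priori bound on the variances. -/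
lemma sum_condCov_sq_le (hp : ∀ s, 0 ≤ p s) (hS : ∑ s ∈ S, p s = 1) (hh : ∀ u, 0 < h u)
    {K : ℝ} (hK : 0 < K) (hSK : ∀ s ∈ S, |s| ≤ K) (i j : Fin n) :
    ∑ X ∈ confs S n, prodWeight p X * h X * condCov p S h ℓ X i j ^ 2 ≤
      K ^ 2 * (∑ X ∈ confs S n, prodWeight p X * h X * condCov p S h ℓ X i i -
        ∑ X ∈ confs S n, prodWeight p X * h X *
          condCov p S h (Function.update ℓ j true) X i i) := by
  set ℓ₁ := Function.update ℓ j true with hℓ₁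
  have hsub : ∀ k, ℓ k = true → ℓ₁ k = true := fun k hk => by
    by_cases hkj : k = j
    · rw [hkj, hℓ₁, Function.update_self]
    · rw [hℓ₁, Function.update_of_ne hkj, hk]
  set t : (Fin n → ℝ) → ℝ := fun X => condCov p S h ℓ X i j / K ^ 2 with ht
  set b : Fin n → (Fin n → ℝ) → ℝ := fun k X => condAvg p S h ℓ X (fun u => u k) with hb
  have hb' : ∀ k X x, b k (mix ℓ₁ X x) = b k X := fun k X x => condAvg_mix hsub X x _
  have hb'' : ∀ k X x, b k (mix ℓ X x) = b k X := fun k X x => condAvg_mix (fun _ => id) X x _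
  have ht' : ∀ X x, t (mix ℓ₁ X x) = t X := fun X x => by
    simp only [ht, condCov, condAvg_mix hsub]
  have ht'' : ∀ X x, t (mix ℓ X x) = t X := fun X x => by
    simp only [ht, condCov, condAvg_mix (ℓ := ℓ) (ℓ' := ℓ) (fun _ => id)]
  have hj₁ : ∀ X x, mix ℓ₁ X x j = X j := fun X x => by simp [mix, hℓ₁]
  have hw : ∀ X, 0 ≤ prodWeight p X * h X := fun X =>
    mul_nonneg (prodWeight_nonneg hp X) (hh X).le
  have e0 := sum_condAvg (ℓ := ℓ) hp hS hh
    (fun u X => (u i - b i X - t X * (u j - b j X)) ^ 2) (fun u X x => by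
      simp only [hb'', ht''])
  have e1 := sum_condAvg (ℓ := ℓ₁) hp hS hh
    (fun u X => (u i - (b i X + t X * (X j - b j X))) ^ 2) (fun u X x => by
      simp only [hb', ht', hj₁])
  have e2 : ∑ X ∈ confs S n, prodWeight p X * h X * condCov p S h ℓ₁ X i i ≤
      ∑ X ∈ confs S n, prodWeight p X * h X *
        condAvg p S h ℓ₁ X (fun u => (u i - (b i X + t X * (X j - b j X))) ^ 2) :=
    sum_le_sum fun X _ => mul_le_mul_of_nonneg_left (by
      rw [condAvg_sq_sub hp hS hh]
      exact le_add_of_nonneg_right (sq_nonneg _)) (hw X)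
  have e3 : ∑ X ∈ confs S n, prodWeight p X * h X *
        condAvg p S h ℓ X (fun u => (u i - b i X - t X * (u j - b j X)) ^ 2) ≤
      ∑ X ∈ confs S n, prodWeight p X * h X *
        (condCov p S h ℓ X i i - condCov p S h ℓ X i j ^ 2 / K ^ 2) :=
    sum_le_sum fun X hX => mul_le_mul_of_nonneg_left (by
      rw [hb, condAvg_sq_residual hp hS hh]
      have h1 := condCov_self_le (ℓ := ℓ) hp hS hh hSK hX j
      have h2 : t X ^ 2 * condCov p S h ℓ X j j ≤ t X ^ 2 * K ^ 2 :=
        mul_le_mul_of_nonneg_left h1 (sq_nonneg _)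
      have h3 : t X ^ 2 * K ^ 2 = condCov p S h ℓ X i j ^ 2 / K ^ 2 := by
        rw [ht]; field_simp
      have h4 : t X * condCov p S h ℓ X i j = condCov p S h ℓ X i j ^ 2 / K ^ 2 := by
        rw [ht]; ring
      linarith) (hw X)
  have e4 : ∑ X ∈ confs S n, prodWeight p X * h X *
        (condCov p S h ℓ X i i - condCov p S h ℓ X i j ^ 2 / K ^ 2) =
      ∑ X ∈ confs S n, prodWeight p X * h X * condCov p S h ℓ X i i -
        (∑ X ∈ confs S n, prodWeight p X * h X * condCov p S h ℓ X i j ^ 2) / K ^ 2 := by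
    rw [sum_div, ← sum_sub_distrib]
    exact sum_congr rfl fun X _ => by ring
  have e5 : ∑ X ∈ confs S n, prodWeight p X * h X * (X i - (b i X + t X * (X j - b j X))) ^ 2 =
      ∑ X ∈ confs S n, prodWeight p X * h X * (X i - b i X - t X * (X j - b j X)) ^ 2 :=
    sum_congr rfl fun X _ => by ring
  have e6 : (∑ X ∈ confs S n, prodWeight p X * h X * condCov p S h ℓ X i j ^ 2) / K ^ 2 ≤
      ∑ X ∈ confs S n, prodWeight p X * h X * condCov p S h ℓ X i i -
        ∑ X ∈ confs S n, prodWeight p X * h X * condCov p S h ℓ₁ X i i := by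
    linarith
  rw [div_le_iff₀ (by positivity)] at e6
  linarith

end condAvg

section overlap

variable {n : ℕ} {p : ℝ → ℝ} {S : Finset ℝ} {h : (Fin n → ℝ) → ℝ} {ℓ : Fin n → Bool}
  {X : Fin n → ℝ}

/-- Conditional mean of the configuration. -/
def condMean (p : ℝ → ℝ) (S : Finset ℝ) (h : (Fin n → ℝ) → ℝ) (ℓ : Fin n → Bool)
    (X : Fin n → ℝ) : Fin n → ℝ :=
  fun i => condAvg p S h ℓ X (fun u => u i)

lemma ndot_sq (u v : Fin n → ℝ) :
    ndot n u v ^ 2 = (1 / n : ℝ) ^ 2 * ∑ i, ∑ j, u i * u j * (v i * v j) := by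
  rw [ndot, mul_pow, sq (∑ i, u i * v i), sum_mul_sum]
  congr 1
  exact sum_congr rfl fun i _ => sum_congr rfl fun j _ => by ring

lemma ndot_comm (u v : Fin n → ℝ) : ndot n u v = ndot n v u := by
  simp only [ndot, mul_comm]

lemma condAvg_ndot (u : Fin n → ℝ) :
    condAvg p S h ℓ X (fun v => ndot n u v) = ndot n u (condMean p S h ℓ X) := by
  simp only [ndot, condAvg_const_mul, condAvg_sum, condMean]

lemma condAvg_ndot_sub_sq (hp : ∀ s, 0 ≤ p s) (hS : ∑ s ∈ S, p s = 1) (hh : ∀ u, 0 < h u)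
    (u : Fin n → ℝ) (q : ℝ) :
    condAvg p S h ℓ X (fun v => (ndot n u v - q) ^ 2) =
      (1 / n : ℝ) ^ 2 * ∑ i, ∑ j, u i * u j * condAvg p S h ℓ X (fun v => v i * v j)
        - 2 * q * ndot n u (condMean p S h ℓ X) + q ^ 2 := by
  have : (fun v : Fin n → ℝ => (ndot n u v - q) ^ 2) = fun v =>
      ((1 / n : ℝ) ^ 2 * ∑ i, ∑ j, u i * u j * (v i * v j) - 2 * q * ndot n u v) + q ^ 2 := by
    ext v
    rw [← ndot_sq]
    ring
  rw [this]
  simp only [condAvg_add, condAvg_sub, condAvg_const_mul, condAvg_const hp hS hh, condAvg_sum,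
    condAvg_ndot]

lemma abs_condMean_le (hp : ∀ s, 0 ≤ p s) (hS : ∑ s ∈ S, p s = 1) (hh : ∀ u, 0 < h u)
    {K : ℝ} (hSK : ∀ s ∈ S, |s| ≤ K) (hX : X ∈ confs S n) (i : Fin n) :
    |condMean p S h ℓ X i| ≤ K :=
  abs_condAvg_le hp hS hh hX fun _ hu => hSK _ (Fintype.mem_piFinset.1 hu i)

lemma abs_mul_le_sq {a b K : ℝ} (ha : |a| ≤ K) (hb : |b| ≤ K) : |a * b| ≤ K ^ 2 := by
  rw [abs_mul, sq]
  exact mul_le_mul ha hb (abs_nonneg _) ((abs_nonneg _).trans ha)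

lemma abs_ndot_le {K : ℝ} {u v : Fin n → ℝ} (hu : ∀ i, |u i| ≤ K) (hv : ∀ i, |v i| ≤ K) :
    |ndot n u v| ≤ K ^ 2 := by
  rcases Nat.eq_zero_or_pos n with rfl | hn
  · simp only [ndot, univ_eq_empty, sum_empty, mul_zero, abs_zero]
    exact sq_nonneg K
  have h1 : |∑ i, u i * v i| ≤ n * K ^ 2 := by
    refine (abs_sum_le_sum_abs _ _).trans ?_
    refine (sum_le_sum fun i _ => abs_mul_le_sq (hu i) (hv i)).trans ?_
    simp
  rw [ndot, abs_mul, abs_of_nonneg (by positivity)]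
  have hn' : (0 : ℝ) < n := Nat.cast_pos.2 hn
  rw [one_div, inv_mul_le_iff₀ hn']
  exact h1

/-- The overlap between a sample and the conditional mean concentrates when the conditional
covariances are small. -/
lemma condAvg_ndot_condMean_le (hp : ∀ s, 0 ≤ p s) (hS : ∑ s ∈ S, p s = 1) (hh : ∀ u, 0 < h u)
    {K : ℝ} (hSK : ∀ s ∈ S, |s| ≤ K) (hX : X ∈ confs S n) :
    condAvg p S h ℓ X (fun v => (ndot n (condMean p S h ℓ X) v -
        ndot n (condMean p S h ℓ X) (condMean p S h ℓ X)) ^ 2) ≤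
      2 * K ^ 2 * ((1 / n : ℝ) ^ 2 * ∑ i, ∑ j, |condCov p S h ℓ X i j|) := by
  set b := condMean p S h ℓ X with hb
  have hbK : ∀ i, |b i| ≤ K := abs_condMean_le hp hS hh hSK hX
  rw [condAvg_ndot_sub_sq hp hS hh, ← hb]
  have h1 : (1 / n : ℝ) ^ 2 * ∑ i, ∑ j, b i * b j * condAvg p S h ℓ X (fun v => v i * v j)
        - 2 * ndot n b b * ndot n b b + ndot n b b ^ 2 =
      (1 / n : ℝ) ^ 2 * ∑ i, ∑ j, b i * b j * condCov p S h ℓ X i j := by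
    have h2 := ndot_sq b b
    have h3 : ∑ i, ∑ j, b i * b j * condCov p S h ℓ X i j =
        ∑ i, ∑ j, b i * b j * condAvg p S h ℓ X (fun v => v i * v j) -
          ∑ i, ∑ j, b i * b j * (b i * b j) := by
      simp only [← sum_sub_distrib]
      exact sum_congr rfl fun i _ => sum_congr rfl fun j _ => by
        rw [condCov, hb]; simp only [condMean]; ring
    rw [h3]
    linear_combination -h2
  rw [h1, mul_left_comm (2 * K ^ 2), mul_sum (univ : Finset (Fin n)) _ (2 * K ^ 2)]
  refine mul_le_mul_of_nonneg_left (sum_le_sum fun i _ => ?_) (sq_nonneg _)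
  rw [mul_sum]
  refine sum_le_sum fun j _ => ?_
  refine (le_abs_self _).trans ?_
  rw [abs_mul]
  refine mul_le_mul_of_nonneg_right ?_ (abs_nonneg _)
  have := abs_mul_le_sq (hbK i) (hbK j)
  nlinarith [sq_nonneg K]

/-- The overlap between two samples concentrates when the conditional covariances are small. -/
lemma condAvg_condAvg_ndot_le (hp : ∀ s, 0 ≤ p s) (hS : ∑ s ∈ S, p s = 1) (hh : ∀ u, 0 < h u)
    {K : ℝ} (hSK : ∀ s ∈ S, |s| ≤ K) (hX : X ∈ confs S n) :
    condAvg p S h ℓ X (fun u => condAvg p S h ℓ X (fun v => (ndot n u v -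
        ndot n (condMean p S h ℓ X) (condMean p S h ℓ X)) ^ 2)) ≤
      2 * K ^ 2 * ((1 / n : ℝ) ^ 2 * ∑ i, ∑ j, |condCov p S h ℓ X i j|) := by
  set b := condMean p S h ℓ X with hb
  have hbK : ∀ i, |b i| ≤ K := abs_condMean_le hp hS hh hSK hX
  have hcomm : ∀ (i j : Fin n) (u : Fin n → ℝ), u i * u j *
      condAvg p S h ℓ X (fun v => v i * v j) = condAvg p S h ℓ X (fun v => v i * v j) *
        (u i * u j) := fun i j u => mul_comm _ _
  simp only [condAvg_ndot_sub_sq hp hS hh, ← hb, hcomm, ndot_comm (v := b)]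
  simp only [condAvg_add, condAvg_sub, condAvg_const_mul, condAvg_const hp hS hh, condAvg_sum,
    condAvg_ndot, ← hb]
  have h1 : (1 / n : ℝ) ^ 2 * ∑ i, ∑ j, condAvg p S h ℓ X (fun v => v i * v j) *
        condAvg p S h ℓ X (fun v => v i * v j)
        - 2 * ndot n b b * ndot n b b + ndot n b b ^ 2 =
      (1 / n : ℝ) ^ 2 * ∑ i, ∑ j, (condAvg p S h ℓ X (fun v => v i * v j) + b i * b j) *
        condCov p S h ℓ X i j := by
    have h2 := ndot_sq b b
    have h3 : ∑ i, ∑ j, (condAvg p S h ℓ X (fun v => v i * v j) + b i * b j) *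
        condCov p S h ℓ X i j =
        ∑ i, ∑ j, condAvg p S h ℓ X (fun v => v i * v j) *
          condAvg p S h ℓ X (fun v => v i * v j) - ∑ i, ∑ j, b i * b j * (b i * b j) := by
      simp only [← sum_sub_distrib]
      exact sum_congr rfl fun i _ => sum_congr rfl fun j _ => by
        rw [condCov, hb]; simp only [condMean]; ring
    rw [h3]
    linear_combination -h2
  rw [h1, mul_left_comm (2 * K ^ 2), mul_sum (univ : Finset (Fin n)) _ (2 * K ^ 2)]
  refine mul_le_mul_of_nonneg_left (sum_le_sum fun i _ => ?_) (sq_nonneg _)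
  rw [mul_sum]
  refine sum_le_sum fun j _ => ?_
  refine (le_abs_self _).trans ?_
  rw [abs_mul]
  refine mul_le_mul_of_nonneg_right ?_ (abs_nonneg _)
  have h4 := abs_mul_le_sq (hbK i) (hbK j)
  have h5 : |condAvg p S h ℓ X (fun v => v i * v j)| ≤ K ^ 2 :=
    abs_condAvg_le hp hS hh hX fun u hu => abs_mul_le_sq
      (hSK _ (Fintype.mem_piFinset.1 hu i)) (hSK _ (Fintype.mem_piFinset.1 hu j))
  exact (abs_add_le _ _).trans (by linarith)

end overlap

section Gaussian

instance : IsProbabilityMeasure stdGauss := by rw [stdGauss]; infer_instance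

/-- The standard Gaussian measure on `ι → ℝ`. -/
abbrev stdGaussPi (ι : Type*) [Fintype ι] : Measure (ι → ℝ) := Measure.pi fun _ : ι => stdGauss

variable {ι : Type*} [Fintype ι]

lemma integral_exp_mul_stdGauss (a : ℝ) : ∫ x, Real.exp (a * x) ∂stdGauss = Real.exp (a ^ 2 / 2) := by
  have := congrFun (mgf_id_gaussianReal (μ := 0) (v := 1)) a
  simpa [mgf, stdGauss] using this

lemma integrable_exp_dotProduct (a : ι → ℝ) :
    Integrable (fun z => Real.exp (a ⬝ᵥ z)) (stdGaussPi ι) := by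
  simp only [dotProduct, Real.exp_sum]
  exact Integrable.fintype_prod (f := fun i x => Real.exp (a i * x)) fun i =>
    integrable_exp_mul_gaussianReal _

lemma integral_exp_dotProduct (a : ι → ℝ) :
    ∫ z, Real.exp (a ⬝ᵥ z) ∂stdGaussPi ι = Real.exp (a ⬝ᵥ a / 2) := by
  simp only [dotProduct, Real.exp_sum]
  rw [integral_fintype_prod_eq_prod (fun i x => Real.exp (a i * x))]
  simp only [integral_exp_mul_stdGauss, ← Real.exp_sum, sum_div, sq]

lemma integrable_dotProduct (a : ι → ℝ) : Integrable (fun z => a ⬝ᵥ z) (stdGaussPi ι) := by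
  simp only [dotProduct]
  refine integrable_finsetSum _ fun i _ => ?_
  have h1 : Integrable (fun x : ℝ => x) stdGauss :=
    memLp_one_iff_integrable.1 (memLp_id_gaussianReal (μ := 0) (v := 1) 1)
  exact (integrable_comp_eval (μ := fun _ : ι => stdGauss) (i := i) h1).const_mul (a i)

lemma integral_dotProduct (a : ι → ℝ) : ∫ z, a ⬝ᵥ z ∂stdGaussPi ι = 0 := by
  have h1 : Integrable (fun x : ℝ => x) stdGauss :=
    memLp_one_iff_integrable.1 (memLp_id_gaussianReal (μ := 0) (v := 1) 1)
  simp only [dotProduct]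
  rw [integral_finsetSum _ fun i _ =>
    (integrable_comp_eval (μ := fun _ : ι => stdGauss) (i := i) h1).const_mul (a i)]
  refine sum_eq_zero fun i _ => ?_
  rw [integral_const_mul, integral_comp_eval (μ := fun _ : ι => stdGauss) (i := i)
    (f := fun x => x) h1.aestronglyMeasurable, stdGauss, integral_id_gaussianReal, mul_zero]

lemma integral_indicator_exp_stdGauss (a : ℝ) {s : Set ℝ} (hs : MeasurableSet s) :
    ∫ x, s.indicator (fun x => Real.exp (a * x - a * a / 2)) x ∂stdGauss =
      (gaussianReal a 1).real s := by
  rw [← integral_indicator_one hs, stdGauss, integral_gaussianReal_eq_integral_smul one_ne_zero,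
    integral_gaussianReal_eq_integral_smul one_ne_zero]
  refine integral_congr_ae (Eventually.of_forall fun x => ?_)
  by_cases hx : x ∈ s
  · simp only [Set.indicator_of_mem hx, gaussianPDFReal, smul_eq_mul, Pi.one_apply, mul_one]
    rw [mul_assoc, ← Real.exp_add]
    congr 2
    simp
    ring
  · simp only [Set.indicator_of_notMem hx, smul_zero]

/-- The Cameron–Martin formula for the standard Gaussian measure on `ι → ℝ`. -/
lemma map_add_stdGaussPi (a : ι → ℝ) :
    (stdGaussPi ι).map (fun z => z + a) =
      (stdGaussPi ι).withDensity fun z => ENNReal.ofReal (Real.exp (a ⬝ᵥ z - a ⬝ᵥ a / 2)) := by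
  have h1 : ∀ i, stdGauss.map (fun x => x + a i) = gaussianReal (a i) 1 := fun i => by
    rw [stdGauss, gaussianReal_map_add_const, zero_add]
  have h2 : (stdGaussPi ι).map (fun z => z + a) = Measure.pi fun i => gaussianReal (a i) 1 := by
    have h3 : ∀ i, IsProbabilityMeasure (stdGauss.map (fun x => x + a i)) := fun i => by
      rw [h1]; infer_instance
    have := Measure.pi_map_pi (μ := fun _ : ι => stdGauss) (f := fun i x => x + a i)
      (fun i => (measurable_id.add_const _).aemeasurable)
    simp only [h1] at this
    exact this
  rw [h2]
  refine Measure.pi_eq fun s hs => ?_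
  have hs' : MeasurableSet (Set.univ.pi s) := MeasurableSet.univ_pi hs
  rw [withDensity_apply _ hs', ← lintegral_indicator hs']
  have h4 : ∀ z : ι → ℝ, (Set.univ.pi s).indicator
      (fun z => ENNReal.ofReal (Real.exp (a ⬝ᵥ z - a ⬝ᵥ a / 2))) z =
      ENNReal.ofReal (∏ i, (s i).indicator (fun x => Real.exp (a i * x - a i * a i / 2)) (z i)) := by
    intro z
    by_cases hz : z ∈ Set.univ.pi s
    · rw [Set.indicator_of_mem hz]
      congr 1
      rw [prod_congr rfl fun i _ => Set.indicator_of_mem (hz i (Set.mem_univ i)) _, ← Real.exp_sum]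
      simp only [dotProduct, sum_sub_distrib, sum_div]
    · rw [Set.indicator_of_notMem hz]
      simp only [Set.mem_pi, Set.mem_univ, true_implies, not_forall] at hz
      obtain ⟨i, hi⟩ := hz
      rw [prod_eq_zero (mem_univ i) (Set.indicator_of_notMem hi _), ENNReal.ofReal_zero]
  have h6 : ∀ i, Integrable
      ((s i).indicator (fun x => Real.exp (a i * x - a i * a i / 2))) stdGauss := fun i => by
    refine Integrable.indicator ?_ (hs i)
    simp only [Real.exp_sub]
    exact (integrable_exp_mul_gaussianReal _).div_const _
  simp only [h4]
  rw [← ofReal_integral_eq_lintegral_ofReal (Integrable.fintype_prod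
      (f := fun i => (s i).indicator (fun x => Real.exp (a i * x - a i * a i / 2))) h6)
      (Eventually.of_forall fun z => prod_nonneg fun i _ =>
        Set.indicator_nonneg (fun _ _ => (Real.exp_pos _).le) _),
    integral_fintype_prod_eq_prod
      (fun i => (s i).indicator (fun x => Real.exp (a i * x - a i * a i / 2)))]
  rw [prod_congr rfl fun i _ => integral_indicator_exp_stdGauss (a i) (hs i)]
  rw [ENNReal.ofReal_prod_of_nonneg fun _ _ => measureReal_nonneg]
  exact prod_congr rfl fun i _ => ofReal_measureReal

lemma integral_add_stdGaussPi (a : ι → ℝ) {f : (ι → ℝ) → ℝ} :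
    ∫ z, f (z + a) ∂stdGaussPi ι =
      ∫ z, Real.exp (a ⬝ᵥ z - a ⬝ᵥ a / 2) * f z ∂stdGaussPi ι := by
  have hm : Measurable fun z : ι → ℝ => Real.exp (a ⬝ᵥ z - a ⬝ᵥ a / 2) := by
    unfold dotProduct; fun_prop
  have h1 : ∫ z, f (z + a) ∂stdGaussPi ι = ∫ z, f z ∂(stdGaussPi ι).map (fun z => z + a) :=
    ((MeasurableEquiv.addRight a).measurableEmbedding.integral_map f).symm
  rw [h1, map_add_stdGaussPi, integral_withDensity_eq_integral_toReal_smul hm.ennreal_ofReal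
    (Eventually.of_forall fun _ => ENNReal.ofReal_lt_top)]
  simp only [ENNReal.toReal_ofReal (Real.exp_pos _).le, smul_eq_mul]

variable {κ : Type*} [Fintype κ]

/-- The standard Gaussian measure on `(ι → ℝ) × (κ → ℝ)`. -/
abbrev stdGaussProd (ι κ : Type*) [Fintype ι] [Fintype κ] : Measure ((ι → ℝ) × (κ → ℝ)) :=
  (stdGaussPi ι).prod (stdGaussPi κ)

/-- The Euclidean scalar product on `(ι → ℝ) × (κ → ℝ)`. -/
def pdot (v w : (ι → ℝ) × (κ → ℝ)) : ℝ := v.1 ⬝ᵥ w.1 + v.2 ⬝ᵥ w.2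

lemma pdot_comm (v w : (ι → ℝ) × (κ → ℝ)) : pdot v w = pdot w v := by
  simp only [pdot, dotProduct_comm]

lemma pdot_add_left (u v w : (ι → ℝ) × (κ → ℝ)) : pdot (u + v) w = pdot u w + pdot v w := by
  simp only [pdot, Prod.fst_add, Prod.snd_add, add_dotProduct]; ring

lemma pdot_smul_left (c : ℝ) (v w : (ι → ℝ) × (κ → ℝ)) : pdot (c • v) w = c * pdot v w := by
  simp only [pdot, Prod.smul_fst, Prod.smul_snd, smul_dotProduct, smul_eq_mul]; ring

lemma measurable_pdot (v : (ι → ℝ) × (κ → ℝ)) : Measurable fun G => pdot v G := by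
  unfold pdot dotProduct; fun_prop

lemma integrable_exp_pdot (v : (ι → ℝ) × (κ → ℝ)) :
    Integrable (fun G => Real.exp (pdot v G)) (stdGaussProd ι κ) := by
  simp only [pdot, Real.exp_add]
  exact (integrable_exp_dotProduct v.1).mul_prod (integrable_exp_dotProduct v.2)

lemma integral_exp_pdot (v : (ι → ℝ) × (κ → ℝ)) :
    ∫ G, Real.exp (pdot v G) ∂stdGaussProd ι κ = Real.exp (pdot v v / 2) := by
  simp only [pdot, Real.exp_add]
  rw [integral_prod_mul (fun z => Real.exp (v.1 ⬝ᵥ z)) (fun z => Real.exp (v.2 ⬝ᵥ z)),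
    integral_exp_dotProduct, integral_exp_dotProduct, add_div, Real.exp_add]

lemma integrable_pdot (v : (ι → ℝ) × (κ → ℝ)) :
    Integrable (fun G => pdot v G) (stdGaussProd ι κ) := by
  simp only [pdot]
  exact ((integrable_dotProduct v.1).comp_fst _).add ((integrable_dotProduct v.2).comp_snd _)

lemma integral_pdot (v : (ι → ℝ) × (κ → ℝ)) : ∫ G, pdot v G ∂stdGaussProd ι κ = 0 := by
  simp only [pdot]
  rw [integral_add ((integrable_dotProduct v.1).comp_fst _)
    ((integrable_dotProduct v.2).comp_snd _), integral_fun_fst (fun z => v.1 ⬝ᵥ z),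
    integral_fun_snd (fun z => v.2 ⬝ᵥ z), integral_dotProduct, integral_dotProduct]
  simp

end Gaussian

lemma abs_log_sub_log_le {U V : ℝ} (hU : 0 < U) (hV : 0 < V) {δ : ℝ} (hδ : 0 < δ) :
    |Real.log U - Real.log V| ≤ δ * ((U ^ 2)⁻¹ + (V ^ 2)⁻¹) + 1 / (2 * δ) * (U - V) ^ 2 := by
  have h1 : Real.log U - Real.log V ≤ V⁻¹ * |U - V| := by
    rw [← Real.log_div hU.ne' hV.ne']
    refine (Real.log_le_sub_one_of_pos (div_pos hU hV)).trans ?_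
    rw [show U / V - 1 = V⁻¹ * (U - V) by field_simp]
    exact mul_le_mul_of_nonneg_left (le_abs_self _) (inv_pos.2 hV).le
  have h2 : Real.log V - Real.log U ≤ U⁻¹ * |U - V| := by
    rw [← Real.log_div hV.ne' hU.ne']
    refine (Real.log_le_sub_one_of_pos (div_pos hV hU)).trans ?_
    rw [show V / U - 1 = U⁻¹ * (V - U) by field_simp, abs_sub_comm]
    exact mul_le_mul_of_nonneg_left (le_abs_self _) (inv_pos.2 hU).le
  have h3 : |Real.log U - Real.log V| ≤ (U⁻¹ + V⁻¹) * |U - V| := by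
    have h4 := mul_nonneg (inv_pos.2 hU).le (abs_nonneg (U - V))
    have h5 := mul_nonneg (inv_pos.2 hV).le (abs_nonneg (U - V))
    rw [abs_le, add_mul]
    constructor <;> linarith
  refine h3.trans ?_
  rw [← inv_pow, ← inv_pow, ← sq_abs (U - V)]
  set a := U⁻¹
  set b := V⁻¹
  set t := |U - V|
  have h6 : δ * (a ^ 2 + b ^ 2) + 1 / (2 * δ) * t ^ 2 - (a + b) * t =
      δ / 2 * (a - b) ^ 2 + 1 / (2 * δ) * (δ * (a + b) - t) ^ 2 := by
    field_simp
    ring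
  have h7 : 0 ≤ δ / 2 * (a - b) ^ 2 + 1 / (2 * δ) * (δ * (a + b) - t) ^ 2 := by positivity
  linarith

lemma abs_exp_sub_exp_le {a b M : ℝ} (ha : a ≤ M) (hb : b ≤ M) :
    |Real.exp a - Real.exp b| ≤ Real.exp M * |a - b| := by
  have key : ∀ {a b : ℝ}, a ≤ M → Real.exp a - Real.exp b ≤ Real.exp M * |a - b| := by
    intro a b ha
    have h1 := Real.add_one_le_exp (b - a)
    have h2 : Real.exp a * Real.exp (b - a) = Real.exp b := by
      rw [← Real.exp_add]; congr 1; ring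
    have h3 : Real.exp a * (b - a + 1) ≤ Real.exp b := by
      rw [← h2]; exact mul_le_mul_of_nonneg_left h1 (Real.exp_pos a).le
    have h4 : Real.exp a * (a - b) ≤ Real.exp a * |a - b| :=
      mul_le_mul_of_nonneg_left (le_abs_self _) (Real.exp_pos a).le
    have h5 : Real.exp a * |a - b| ≤ Real.exp M * |a - b| :=
      mul_le_mul_of_nonneg_right (Real.exp_le_exp.2 ha) (abs_nonneg _)
    linarith
  rw [abs_le]
  have h1 := key (b := b) ha
  have h2 := key (b := a) hb
  rw [abs_sub_comm] at h2
  constructor <;> linarith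

section average

variable {α : Type*} {C : Finset α} {q : α → ℝ}

lemma avg_exp_pos (hq : ∀ x ∈ C, 0 ≤ q x) (hq1 : ∑ x ∈ C, q x = 1) (y : α → ℝ) :
    0 < ∑ x ∈ C, q x * Real.exp (y x) := by
  have h0 : ∀ x ∈ C, 0 ≤ q x * Real.exp (y x) := fun x hx =>
    mul_nonneg (hq x hx) (Real.exp_pos _).le
  refine lt_of_le_of_ne (sum_nonneg h0) fun h1 => ?_
  have h2 := (sum_eq_zero_iff_of_nonneg h0).1 h1.symm
  rw [sum_eq_zero fun x hx => (mul_eq_zero.1 (h2 x hx)).resolve_right (Real.exp_pos _).ne'] at hq1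
  exact zero_ne_one hq1

lemma abs_log_avg_exp_le (hq : ∀ x ∈ C, 0 ≤ q x) (hq1 : ∑ x ∈ C, q x = 1) (y : α → ℝ) :
    |Real.log (∑ x ∈ C, q x * Real.exp (y x))| ≤ ∑ x ∈ C, |y x| := by
  have h1 : ∀ x ∈ C, |y x| ≤ ∑ x ∈ C, |y x| := fun x hx =>
    single_le_sum (f := fun x => |y x|) (fun _ _ => abs_nonneg _) hx
  set M := ∑ x ∈ C, |y x|
  have hpos := avg_exp_pos hq hq1 y
  rw [abs_le]
  constructor
  · rw [Real.le_log_iff_exp_le hpos]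
    calc Real.exp (-M) = ∑ x ∈ C, q x * Real.exp (-M) := by rw [← sum_mul, hq1, one_mul]
      _ ≤ _ := sum_le_sum fun x hx => mul_le_mul_of_nonneg_left
        (Real.exp_le_exp.2 (by have := h1 x hx; have := neg_abs_le (y x); linarith)) (hq x hx)
  · rw [Real.log_le_iff_le_exp hpos]
    calc _ ≤ ∑ x ∈ C, q x * Real.exp M := sum_le_sum fun x hx => mul_le_mul_of_nonneg_left
          (Real.exp_le_exp.2 ((le_abs_self _).trans (h1 x hx))) (hq x hx)
      _ = Real.exp M := by rw [← sum_mul, hq1, one_mul]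

lemma inv_sq_avg_exp_le (hq : ∀ x ∈ C, 0 ≤ q x) (hq1 : ∑ x ∈ C, q x = 1) (y : α → ℝ) :
    ((∑ x ∈ C, q x * Real.exp (y x)) ^ 2)⁻¹ ≤ ∑ x ∈ C, q x * Real.exp (-(2 * y x)) := by
  have hpos := avg_exp_pos hq hq1 y
  set U := ∑ x ∈ C, q x * Real.exp (y x) with hU
  have h1 : ∀ x ∈ C, q x * (3 * (U ^ 2)⁻¹ - 2 * (U ^ 3)⁻¹ * Real.exp (y x)) ≤
      q x * Real.exp (-(2 * y x)) := fun x hx => by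
    refine mul_le_mul_of_nonneg_left ?_ (hq x hx)
    have ht := Real.exp_pos (y x)
    have h2 : Real.exp (-(2 * y x)) = (Real.exp (y x) ^ 2)⁻¹ := by
      rw [Real.exp_neg, two_mul, Real.exp_add, sq]
    rw [h2]
    set t := Real.exp (y x)
    have h3 : (t ^ 2)⁻¹ - (3 * (U ^ 2)⁻¹ - 2 * (U ^ 3)⁻¹ * t) =
        (t - U) ^ 2 * (2 * t + U) / (t ^ 2 * U ^ 3) := by
      field_simp
      ring
    have h4 : 0 ≤ (t - U) ^ 2 * (2 * t + U) / (t ^ 2 * U ^ 3) := by positivity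
    linarith
  refine le_trans (le_of_eq ?_) (sum_le_sum h1)
  have h5 : ∀ x, q x * (3 * (U ^ 2)⁻¹ - 2 * (U ^ 3)⁻¹ * Real.exp (y x)) =
      3 * (U ^ 2)⁻¹ * q x - 2 * (U ^ 3)⁻¹ * (q x * Real.exp (y x)) := fun x => by ring
  simp only [h5]
  rw [sum_sub_distrib, ← mul_sum, ← mul_sum, hq1, ← hU]
  field_simp
  ring

end average

section comparison

variable {ι κ : Type*} [Fintype ι] [Fintype κ]

lemma integrable_exp_pdot_add (w : (ι → ℝ) × (κ → ℝ)) (c : ℝ) :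
    Integrable (fun G => Real.exp (pdot w G + c)) (stdGaussProd ι κ) := by
  simp only [Real.exp_add]
  exact (integrable_exp_pdot w).mul_const _

lemma integral_exp_pdot_add (w : (ι → ℝ) × (κ → ℝ)) (c : ℝ) :
    ∫ G, Real.exp (pdot w G + c) ∂stdGaussProd ι κ = Real.exp (pdot w w / 2 + c) := by
  simp only [Real.exp_add]
  rw [integral_mul_const, integral_exp_pdot]

variable {α : Type*} {C : Finset α} {q : α → ℝ}

/-- Comparison of the averaged exponential of a Gaussian field with the exponential of a single
Gaussian variable, in terms of the differences between the covariances. -/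
lemma abs_integral_log_avg_exp_sub_le (hq : ∀ x ∈ C, 0 ≤ q x) (hq1 : ∑ x ∈ C, q x = 1)
    (v : α → (ι → ℝ) × (κ → ℝ)) (a b : (ι → ℝ) × (κ → ℝ)) {M : ℝ}
    (hvv : ∀ x ∈ C, ∀ y ∈ C, pdot (v x) (v y) ∈ Set.Icc 0 M)
    (hva : ∀ x ∈ C, pdot (v x) a ∈ Set.Icc 0 M) (hvb : ∀ x ∈ C, pdot (v x) b ∈ Set.Icc 0 M)
    (hbb : pdot b b ∈ Set.Icc 0 M) {δ : ℝ} (hδ : 0 < δ) :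
    |∫ G, Real.log (∑ x ∈ C, q x * Real.exp (pdot (v x) G +
        (pdot (v x) a - pdot (v x) (v x) / 2))) ∂stdGaussProd ι κ - pdot b b / 2| ≤
      δ * (2 * Real.exp (3 * M)) + 1 / (2 * δ) * (Real.exp (3 * M) *
        (∑ x ∈ C, q x * ∑ y ∈ C, q y * |pdot (v x) (v y) - pdot b b| +
          4 * ∑ x ∈ C, q x * |pdot (v x) a - pdot b b| +
          2 * ∑ x ∈ C, q x * |pdot (v x) b - pdot b b|)) := by
  set k : α → ℝ := fun x => pdot (v x) a - pdot (v x) (v x) / 2 with hk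
  set m : ℝ := pdot b b / 2 with hm
  set e : (ι → ℝ) × (κ → ℝ) → ℝ → (ι → ℝ) × (κ → ℝ) → ℝ :=
    fun w c G => Real.exp (pdot w G + c) with he
  have hei : ∀ w c, Integrable (e w c) (stdGaussProd ι κ) := integrable_exp_pdot_add
  set U : (ι → ℝ) × (κ → ℝ) → ℝ :=
    fun G => ∑ x ∈ C, q x * Real.exp (pdot (v x) G + k x) with hU
  set D₁ : (ι → ℝ) × (κ → ℝ) → ℝ := fun G =>
    ∑ x ∈ C, q x * e ((-2 : ℝ) • v x) (-2 * k x) G + e ((-2 : ℝ) • b) (-2 * m) G with hD₁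
  set D₂ : (ι → ℝ) × (κ → ℝ) → ℝ := fun G =>
    ∑ x ∈ C, q x * ∑ y ∈ C, q y * e (v x + v y) (k x + k y) G -
      2 * ∑ x ∈ C, q x * e (v x + b) (k x + m) G + e (b + b) (m + m) G with hD₂
  have hD₁i : Integrable D₁ (stdGaussProd ι κ) :=
    (integrable_finsetSum _ fun x _ => (hei _ _).const_mul _).add (hei _ _)
  have hD₂a : ∀ x, Integrable (fun G => ∑ y ∈ C, q y * e (v x + v y) (k x + k y) G)
    (stdGaussProd ι κ) := fun x => integrable_finsetSum _ fun y _ => (hei _ _).const_mul _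
  have hD₂b : Integrable (fun G => ∑ x ∈ C, q x * ∑ y ∈ C, q y * e (v x + v y) (k x + k y) G)
    (stdGaussProd ι κ) := integrable_finsetSum _ fun x _ => (hD₂a x).const_mul _
  have hD₂c : Integrable (fun G => 2 * ∑ x ∈ C, q x * e (v x + b) (k x + m) G)
    (stdGaussProd ι κ) := (integrable_finsetSum _ fun x _ => (hei _ _).const_mul _).const_mul _
  have hD₂i : Integrable D₂ (stdGaussProd ι κ) := (hD₂b.sub hD₂c).add (hei _ _)
  have hUpos : ∀ G, 0 < U G := fun G => avg_exp_pos hq hq1 _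
  have hlogU : Integrable (fun G => Real.log (U G)) (stdGaussProd ι κ) := by
    have h1 : Integrable (fun G => ∑ x ∈ C, |pdot (v x) G + k x|) (stdGaussProd ι κ) :=
      integrable_finsetSum _ fun x _ => ((integrable_pdot (v x)).add (integrable_const _)).abs
    refine h1.mono' ?_ (Eventually.of_forall fun G => abs_log_avg_exp_le hq hq1 _)
    refine (Real.measurable_log.comp (Finset.measurable_sum _ fun x _ => ?_)).aestronglyMeasurable
    exact ((measurable_pdot (v x)).add_const _).exp.const_mul _
  have hlogV : Integrable (fun G => pdot b G + m) (stdGaussProd ι κ) :=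
    (integrable_pdot b).add (integrable_const _)
  have hIV : ∫ G, (pdot b G + m) ∂stdGaussProd ι κ = m := by
    rw [integral_add (integrable_pdot b) (integrable_const _), integral_pdot]
    simp
  have hpt : ∀ G, |Real.log (U G) - (pdot b G + m)| ≤ δ * D₁ G + 1 / (2 * δ) * D₂ G := by
    intro G
    have h1 := abs_log_sub_log_le (hUpos G) (Real.exp_pos (pdot b G + m)) hδ
    rw [Real.log_exp] at h1
    refine h1.trans (add_le_add (mul_le_mul_of_nonneg_left (add_le_add ?_ (le_of_eq ?_)) hδ.le)
      (le_of_eq ?_))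
    · refine (inv_sq_avg_exp_le hq hq1 _).trans (le_of_eq (sum_congr rfl fun x _ => ?_))
      simp only [he, pdot_smul_left]
      congr 2
      ring
    · simp only [he, pdot_smul_left]
      rw [← Real.exp_nat_mul, ← Real.exp_neg]
      congr 1
      push_cast
      ring
    · congr 1
      have h2 : ∑ x ∈ C, q x * ∑ y ∈ C, q y * e (v x + v y) (k x + k y) G = U G ^ 2 := by
        rw [sq, hU, sum_mul]
        refine sum_congr rfl fun x _ => ?_
        rw [mul_assoc, mul_sum C _ (Real.exp (pdot (v x) G + k x))]
        congr 1
        refine sum_congr rfl fun y _ => ?_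
        simp only [he, pdot_add_left]
        rw [show pdot (v x) G + pdot (v y) G + (k x + k y) =
          (pdot (v x) G + k x) + (pdot (v y) G + k y) by ring, Real.exp_add]
        ring
      have h3 : ∑ x ∈ C, q x * e (v x + b) (k x + m) G = U G * Real.exp (pdot b G + m) := by
        rw [hU, sum_mul]
        refine sum_congr rfl fun x _ => ?_
        simp only [he, pdot_add_left]
        rw [show pdot (v x) G + pdot b G + (k x + m) =
          (pdot (v x) G + k x) + (pdot b G + m) by ring, Real.exp_add]
        ring
      have h4 : e (b + b) (m + m) G = Real.exp (pdot b G + m) ^ 2 := by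
        simp only [he, pdot_add_left]
        rw [show pdot b G + pdot b G + (m + m) =
          (pdot b G + m) + (pdot b G + m) by ring, Real.exp_add, sq]
      simp only [hD₂, h2, h3, h4]
      ring
  have hE : ∀ w c, ∫ G, e w c G ∂stdGaussProd ι κ = Real.exp (pdot w w / 2 + c) :=
    integral_exp_pdot_add
  have hID₁ : ∫ G, D₁ G ∂stdGaussProd ι κ ≤ 2 * Real.exp (3 * M) := by
    rw [hD₁, integral_add (integrable_finsetSum _ fun x _ => (hei _ _).const_mul _) (hei _ _),
      integral_finsetSum _ fun x _ => (hei _ _).const_mul _, two_mul]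
    simp only [integral_const_mul, hE]
    refine add_le_add ?_ (Real.exp_le_exp.2 ?_)
    · calc _ ≤ ∑ x ∈ C, q x * Real.exp (3 * M) :=
            sum_le_sum fun x hx => mul_le_mul_of_nonneg_left (Real.exp_le_exp.2 ?_) (hq x hx)
        _ = _ := by rw [← sum_mul, hq1, one_mul]
      have h1 := hvv x hx x hx
      have h2 := hva x hx
      rw [pdot_smul_left, pdot_comm, pdot_smul_left, hk]
      simp only
      linarith [h1.1, h1.2, h2.1]
    · rw [pdot_smul_left, pdot_comm, pdot_smul_left, hm]
      linarith [hbb.1, hbb.2]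
  have hID₂ : ∫ G, D₂ G ∂stdGaussProd ι κ ≤ Real.exp (3 * M) *
        (∑ x ∈ C, q x * ∑ y ∈ C, q y * |pdot (v x) (v y) - pdot b b| +
          4 * ∑ x ∈ C, q x * |pdot (v x) a - pdot b b| +
          2 * ∑ x ∈ C, q x * |pdot (v x) b - pdot b b|) := by
    have hsub : Integrable (fun G => ∑ x ∈ C, q x * ∑ y ∈ C, q y * e (v x + v y) (k x + k y) G -
      2 * ∑ x ∈ C, q x * e (v x + b) (k x + m) G) (stdGaussProd ι κ) := hD₂b.sub hD₂c
    rw [hD₂, integral_add hsub (hei _ _), integral_sub hD₂b hD₂c,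
      integral_finsetSum _ fun x _ => (hD₂a x).const_mul _, integral_const_mul,
      integral_finsetSum _ fun x _ => (hei _ _).const_mul _]
    simp only [integral_const_mul, hE,
      fun x => integral_finsetSum C (f := fun y G => q y * e (v x + v y) (k x + k y) G)
        (μ := stdGaussProd ι κ) fun y _ => (hei _ _).const_mul _]
    have hA : ∀ x ∈ C, ∀ y ∈ C, Real.exp (pdot (v x + v y) (v x + v y) / 2 + (k x + k y)) ≤
        Real.exp (3 * pdot b b) + Real.exp (3 * M) * (|pdot (v x) (v y) - pdot b b| +
          |pdot (v x) a - pdot b b| + |pdot (v y) a - pdot b b|) := by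
      intro x hx y hy
      have h1 : pdot (v x + v y) (v x + v y) / 2 + (k x + k y) =
          pdot (v x) (v y) + pdot (v x) a + pdot (v y) a := by
        rw [pdot_add_left, pdot_comm (v x), pdot_comm (v y), pdot_add_left, pdot_add_left,
          pdot_comm (v y) (v x), hk]
        ring
      have h2 := abs_exp_sub_exp_le (M := 3 * M)
        (a := pdot (v x) (v y) + pdot (v x) a + pdot (v y) a) (b := 3 * pdot b b)
        (by linarith [(hvv x hx y hy).2, (hva x hx).2, (hva y hy).2]) (by linarith [hbb.2])
      have h3 : |pdot (v x) (v y) + pdot (v x) a + pdot (v y) a - 3 * pdot b b| ≤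
          |pdot (v x) (v y) - pdot b b| + |pdot (v x) a - pdot b b| +
            |pdot (v y) a - pdot b b| := by
        rw [show pdot (v x) (v y) + pdot (v x) a + pdot (v y) a - 3 * pdot b b =
          (pdot (v x) (v y) - pdot b b) + (pdot (v x) a - pdot b b) +
            (pdot (v y) a - pdot b b) by ring]
        exact abs_add_three _ _ _
      have h4 := mul_le_mul_of_nonneg_left h3 (Real.exp_pos (3 * M)).le
      rw [h1]
      linarith [(abs_le.1 h2).2]
    have hB : ∀ x ∈ C, Real.exp (3 * pdot b b) - Real.exp (3 * M) *
        (|pdot (v x) b - pdot b b| + |pdot (v x) a - pdot b b|) ≤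
        Real.exp (pdot (v x + b) (v x + b) / 2 + (k x + m)) := by
      intro x hx
      have h1 : pdot (v x + b) (v x + b) / 2 + (k x + m) =
          pdot (v x) b + pdot (v x) a + pdot b b := by
        rw [pdot_add_left, pdot_comm (v x), pdot_comm b, pdot_add_left, pdot_add_left,
          pdot_comm b (v x), hk, hm]
        ring
      have h2 := abs_exp_sub_exp_le (M := 3 * M)
        (a := pdot (v x) b + pdot (v x) a + pdot b b) (b := 3 * pdot b b)
        (by linarith [(hvb x hx).2, (hva x hx).2, hbb.2]) (by linarith [hbb.2])
      have h3 : |pdot (v x) b + pdot (v x) a + pdot b b - 3 * pdot b b| ≤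
          |pdot (v x) b - pdot b b| + |pdot (v x) a - pdot b b| := by
        rw [show pdot (v x) b + pdot (v x) a + pdot b b - 3 * pdot b b =
          (pdot (v x) b - pdot b b) + (pdot (v x) a - pdot b b) by ring]
        exact abs_add_le _ _
      have h4 := mul_le_mul_of_nonneg_left h3 (Real.exp_pos (3 * M)).le
      rw [h1]
      linarith [(abs_le.1 h2).1]
    have hC : pdot (b + b) (b + b) / 2 + (m + m) = 3 * pdot b b := by
      rw [pdot_add_left, pdot_comm b, pdot_add_left, hm]
      ring
    rw [hC]
    set E := Real.exp (3 * M)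
    set c := Real.exp (3 * pdot b b)
    set r : α → ℝ := fun x => |pdot (v x) a - pdot b b| with hr
    set r' : α → ℝ := fun x => |pdot (v x) b - pdot b b| with hr'
    set R : α → α → ℝ := fun x y => |pdot (v x) (v y) - pdot b b| with hR
    have hAs : ∑ x ∈ C, q x * ∑ y ∈ C, q y * Real.exp (pdot (v x + v y) (v x + v y) / 2 +
        (k x + k y)) ≤ c + E * (∑ x ∈ C, q x * ∑ y ∈ C, q y * R x y + 2 * ∑ x ∈ C, q x * r x) := by
      calc _ ≤ ∑ x ∈ C, q x * ∑ y ∈ C, q y * (c + E * (R x y + r x + r y)) :=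
            sum_le_sum fun x hx => mul_le_mul_of_nonneg_left (sum_le_sum fun y hy =>
              mul_le_mul_of_nonneg_left (hA x hx y hy) (hq y hy)) (hq x hx)
        _ = ∑ x ∈ C, q x * (c + E * (∑ y ∈ C, q y * R x y + r x + ∑ y ∈ C, q y * r y)) := by
            refine sum_congr rfl fun x _ => ?_
            have : ∀ y, q y * (c + E * (R x y + r x + r y)) =
                (c + E * r x) * q y + E * (q y * R x y) + E * (q y * r y) := fun y => by ring
            simp only [this, sum_add_distrib, ← mul_sum, hq1]
            ring
        _ = _ := by
            have : ∀ x, q x * (c + E * (∑ y ∈ C, q y * R x y + r x + ∑ y ∈ C, q y * r y)) =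
                (c + E * ∑ y ∈ C, q y * r y) * q x + E * (q x * ∑ y ∈ C, q y * R x y) +
                  E * (q x * r x) := fun x => by ring
            simp only [this, sum_add_distrib, ← mul_sum, hq1]
            ring
    have hBs : c - E * (∑ x ∈ C, q x * r' x + ∑ x ∈ C, q x * r x) ≤
        ∑ x ∈ C, q x * Real.exp (pdot (v x + b) (v x + b) / 2 + (k x + m)) := by
      calc _ = ∑ x ∈ C, q x * (c - E * (r' x + r x)) := by
            have : ∀ x, q x * (c - E * (r' x + r x)) =
                c * q x - E * (q x * r' x) - E * (q x * r x) := fun x => by ring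
            simp only [this, sum_sub_distrib, ← mul_sum, hq1]
            ring
        _ ≤ _ := sum_le_sum fun x hx => mul_le_mul_of_nonneg_left (hB x hx) (hq x hx)
    linarith
  have hfin : ∫ G, Real.log (U G) ∂stdGaussProd ι κ - m =
      ∫ G, (Real.log (U G) - (pdot b G + m)) ∂stdGaussProd ι κ := by
    rw [integral_sub hlogU hlogV, hIV]
  rw [hfin]
  calc _ ≤ ∫ G, |Real.log (U G) - (pdot b G + m)| ∂stdGaussProd ι κ := abs_integral_le_integral_abs
    _ ≤ ∫ G, (δ * D₁ G + 1 / (2 * δ) * D₂ G) ∂stdGaussProd ι κ :=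
        integral_mono (hlogU.sub hlogV).abs ((hD₁i.const_mul _).add (hD₂i.const_mul _)) hpt
    _ = δ * ∫ G, D₁ G ∂stdGaussProd ι κ + 1 / (2 * δ) * ∫ G, D₂ G ∂stdGaussProd ι κ := by
        rw [integral_add (hD₁i.const_mul _) (hD₂i.const_mul _), integral_const_mul,
          integral_const_mul]
    _ ≤ _ := add_le_add (mul_le_mul_of_nonneg_left hID₁ hδ.le)
        (mul_le_mul_of_nonneg_left hID₂ (by positivity))

end comparison

section fields

/-- The vector with entry `g a` at `e a` for `a ∈ s`, and zero elsewhere. -/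
def embVec {α β : Type*} [DecidableEq β] (s : Finset α) (e : α → β) (g : α → ℝ) : β → ℝ :=
  fun q => ∑ a ∈ s, if q = e a then g a else 0

lemma embVec_dotProduct {α β : Type*} [DecidableEq β] [Fintype β] (s : Finset α) (e : α → β)
    (g : α → ℝ) (z : β → ℝ) : embVec s e g ⬝ᵥ z = ∑ a ∈ s, g a * z (e a) := by
  simp only [dotProduct, embVec, sum_mul]
  rw [sum_comm]
  exact sum_congr rfl fun a _ => by simp

lemma embVec_apply {α β : Type*} [DecidableEq β] {s : Finset α} {e : α → β}
    (he : Function.Injective e) (g : α → ℝ) {a : α} (ha : a ∈ s) : embVec s e g (e a) = g a := by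
  classical
  simp [embVec, he.eq_iff, ha]

lemma embVec_dotProduct_embVec {α β : Type*} [DecidableEq β] [Fintype β] (s : Finset α)
    {e : α → β} (he : Function.Injective e) (g g' : α → ℝ) :
    embVec s e g ⬝ᵥ embVec s e g' = ∑ a ∈ s, g a * g' a := by
  rw [embVec_dotProduct]
  exact sum_congr rfl fun a ha => by rw [embVec_apply he g' ha]

/-- The embedding of pairs of indices of the small system into those of the large one. -/
def castPair {n : ℕ} (p : Fin n × Fin n) : Fin (n + 1) × Fin (n + 1) :=
  (p.1.castSucc, p.2.castSucc)

lemma castPair_injective {n : ℕ} : Function.Injective (castPair (n := n)) := fun p q h => by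
  simpa [castPair, Prod.ext_iff] using h

/-- The coefficients of the Gaussian part of the cavity Hamiltonian. -/
def hVec (lam : ℝ) {n : ℕ} (u : Fin n → ℝ) : Fin (n + 1) × Fin (n + 1) → ℝ :=
  embVec (pairs n) castPair fun p => Real.sqrt (lam / (n + 1)) * (u p.1 * u p.2)

/-- The coefficients of the Gaussian part of the cavity field `y`. -/
def yVec (lam : ℝ) {n : ℕ} (u : Fin n → ℝ) :
    (Fin (n + 1) → ℝ) × (Fin (n + 1) × Fin (n + 1) → ℝ) :=
  (embVec univ Fin.castSucc fun i => Real.sqrt lam / (Real.sqrt 2 * n) * u i ^ 2,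
    embVec (pairs n) castPair fun p => Real.sqrt lam / n * (u p.1 * u p.2))

lemma sum_sq_eq_sum_pairs {n : ℕ} (t : Fin n → ℝ) :
    (∑ i, t i) ^ 2 = ∑ i, t i ^ 2 + 2 * ∑ p ∈ pairs n, t p.1 * t p.2 := by
  have h1 : ∑ p ∈ pairs n, t p.1 * t p.2 =
      ∑ i, ∑ j, if i < j then t i * t j else 0 := by
    rw [pairs, sum_filter, ← univ_product_univ, sum_product]
  have h2 : ∑ i, ∑ j, (if i < j then t i * t j else 0) =
      ∑ i, ∑ j, if j < i then t i * t j else 0 := by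
    rw [sum_comm]
    simp only [mul_comm]
  have h3 : ∑ i, t i ^ 2 = ∑ i, ∑ j, if i = j then t i * t j else 0 :=
    sum_congr rfl fun i _ => by simp [sq]
  rw [two_mul, h1]
  conv_rhs => rhs; rhs; rw [h2]
  rw [h3, sq, sum_mul_sum, ← sum_add_distrib, ← sum_add_distrib]
  refine sum_congr rfl fun i _ => ?_
  rw [← sum_add_distrib, ← sum_add_distrib]
  refine sum_congr rfl fun j _ => ?_
  rcases lt_trichotomy i j with h | h | h
  · simp [h, h.ne, h.not_gt]
  · simp [h]
  · simp [h, h.ne', h.not_gt]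

lemma pdot_yVec {lam : ℝ} (hlam : 0 < lam) {n : ℕ} (u w : Fin n → ℝ) :
    pdot (yVec lam u) (yVec lam w) = lam / 2 * ndot n u w ^ 2 := by
  have h1 := Real.mul_self_sqrt hlam.le
  have h2 := Real.mul_self_sqrt (zero_le_two : (0 : ℝ) ≤ 2)
  have h3 : (Real.sqrt 2)⁻¹ * (Real.sqrt 2)⁻¹ = (2 : ℝ)⁻¹ := by rw [← mul_inv, h2]
  simp only [pdot, yVec]
  rw [embVec_dotProduct_embVec _ (Fin.castSucc_injective n),
    embVec_dotProduct_embVec _ castPair_injective, ndot, mul_pow, sum_sq_eq_sum_pairs, mul_add,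
    mul_add, mul_sum, mul_sum, mul_sum, mul_sum, mul_sum]
  congr 1
  · refine sum_congr rfl fun i _ => ?_
    calc _ = (Real.sqrt lam * Real.sqrt lam) * ((Real.sqrt 2)⁻¹ * (Real.sqrt 2)⁻¹) *
          ((n : ℝ)⁻¹ ^ 2 * (u i ^ 2 * w i ^ 2)) := by rw [div_eq_mul_inv, mul_inv]; ring
      _ = _ := by rw [h1, h3]; ring
  · refine sum_congr rfl fun p _ => ?_
    calc _ = (Real.sqrt lam * Real.sqrt lam) *
          ((n : ℝ)⁻¹ ^ 2 * (u p.1 * u p.2 * (w p.1 * w p.2))) := by rw [div_eq_mul_inv]; ring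
      _ = _ := by rw [h1]; ring

lemma Hcav_eq {lam : ℝ} (hlam : 0 < lam) {n : ℕ} (ω : CavΩ n) (u : Fin n → ℝ) :
    Hcav n lam ω u = hVec lam u ⬝ᵥ (ω.2.1 + hVec lam fun i => ω.1 i.castSucc) -
      hVec lam u ⬝ᵥ hVec lam u / 2 := by
  have h1 : Real.sqrt (lam / (n + 1)) * Real.sqrt (lam / (n + 1)) = lam / (n + 1) :=
    Real.mul_self_sqrt (by positivity)
  rw [dotProduct_add]
  simp only [hVec]
  rw [embVec_dotProduct, embVec_dotProduct_embVec _ castPair_injective,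
    embVec_dotProduct_embVec _ castPair_injective, ← sum_add_distrib, sum_div, ← sum_sub_distrib,
    Hcav]
  refine sum_congr rfl fun p _ => ?_
  have h2 : lam / (2 * ((n : ℝ) + 1)) = lam / (n + 1) / 2 := by
    rw [mul_comm, div_mul_eq_div_div]
  rw [h2, castPair]
  generalize Real.sqrt (lam / (n + 1)) = r at h1 ⊢
  linear_combination (u p.1 ^ 2 * u p.2 ^ 2 / 2 -
    ω.1 p.1.castSucc * ω.1 p.2.castSucc * u p.1 * u p.2) * h1

lemma yfield_eq {lam : ℝ} (hlam : 0 < lam) {n : ℕ} (ω : CavΩ n) (u : Fin n → ℝ) :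
    yfield n lam ω u = pdot (yVec lam u) ω.2.2.2 +
      (pdot (yVec lam u) (yVec lam fun i => ω.1 i.castSucc) -
        pdot (yVec lam u) (yVec lam u) / 2) := by
  rw [pdot_yVec hlam, pdot_yVec hlam, pdot, yVec]
  simp only
  rw [embVec_dotProduct, embVec_dotProduct, yfield, mul_sum, mul_sum]
  simp only [castPair]
  have h1 : ∀ i : Fin n, Real.sqrt lam / (Real.sqrt 2 * n) * (ω.2.2.2.1 i.castSucc * u i ^ 2) =
    Real.sqrt lam / (Real.sqrt 2 * n) * u i ^ 2 * ω.2.2.2.1 i.castSucc := fun i => by ring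
  have h2 : ∀ p : Fin n × Fin n,
      Real.sqrt lam / n * (u p.1 * u p.2 * ω.2.2.2.2 (p.1.castSucc, p.2.castSucc)) =
      Real.sqrt lam / n * (u p.1 * u p.2) * ω.2.2.2.2 (p.1.castSucc, p.2.castSucc) :=
    fun p => by ring
  simp only [h1, h2]
  ring

/-- The likelihood of the configuration `u` given the Gaussian observation `Y`. -/
def likelihood (lam : ℝ) {n : ℕ} (Y : Fin (n + 1) × Fin (n + 1) → ℝ) (u : Fin n → ℝ) : ℝ :=
  Real.exp (hVec lam u ⬝ᵥ Y - hVec lam u ⬝ᵥ hVec lam u / 2)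

lemma likelihood_pos (lam : ℝ) {n : ℕ} (Y : Fin (n + 1) × Fin (n + 1) → ℝ) (u : Fin n → ℝ) :
    0 < likelihood lam Y u := Real.exp_pos _

lemma gibbs_eq_condAvg {lam : ℝ} (hlam : 0 < lam) (P0 : Measure ℝ) (S : Finset ℝ) {n : ℕ}
    (ω : CavΩ n) (f : (Fin n → ℝ) → ℝ) :
    gibbs P0 S n lam ω f = condAvg (fun s => (P0 {s}).toReal) S
      (likelihood lam (ω.2.1 + hVec lam fun i => ω.1 i.castSucc)) (fun i => ω.2.2.1 i.castSucc)
      (fun i => ω.1 i.castSucc) f := by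
  rw [gibbs, condAvg, sum_div]
  have h1 : ∀ x, xbar n ω x = mix (fun i => ω.2.2.1 i.castSucc) (fun i => ω.1 i.castSucc) x :=
    fun x => rfl
  simp only [condNorm, likelihood, ← Hcav_eq hlam, h1, weight, prodWeight]
  exact sum_congr rfl fun x _ => by ring

lemma Qoverlap_eq_ndot {lam : ℝ} (hlam : 0 < lam) (P0 : Measure ℝ) (S : Finset ℝ) {n : ℕ}
    (ω : CavΩ n) :
    Qoverlap P0 S n lam ω =
      ndot n (condMean (fun s => (P0 {s}).toReal) S
          (likelihood lam (ω.2.1 + hVec lam fun i => ω.1 i.castSucc))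
          (fun i => ω.2.2.1 i.castSucc) fun i => ω.1 i.castSucc)
        (condMean (fun s => (P0 {s}).toReal) S
          (likelihood lam (ω.2.1 + hVec lam fun i => ω.1 i.castSucc))
          (fun i => ω.2.2.1 i.castSucc) fun i => ω.1 i.castSucc) := by
  simp only [Qoverlap, ndot, bcoef, gibbs_eq_condAvg hlam, condMean, sq]

end fields

section overlap

variable {n : ℕ} {p : ℝ → ℝ} {S : Finset ℝ} {h : (Fin n → ℝ) → ℝ} {ℓ : Fin n → Bool}
  {X : Fin n → ℝ}

/-- The squared norm of the conditional mean. -/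
def condOverlap (p : ℝ → ℝ) (S : Finset ℝ) (h : (Fin n → ℝ) → ℝ) (ℓ : Fin n → Bool)
    (X : Fin n → ℝ) : ℝ :=
  ndot n (condMean p S h ℓ X) (condMean p S h ℓ X)

/-- A weighted sum of the fluctuations of the overlaps between two samples, between a sample and
the signal, and between a sample and the conditional mean. -/
def overlapFluct (p : ℝ → ℝ) (S : Finset ℝ) (h : (Fin n → ℝ) → ℝ) (ℓ : Fin n → Bool)
    (X : Fin n → ℝ) : ℝ :=
  condAvg p S h ℓ X (fun u => condAvg p S h ℓ X fun v =>
      (ndot n u v - condOverlap p S h ℓ X) ^ 2) +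
    4 * condAvg p S h ℓ X (fun u => (ndot n u X - condOverlap p S h ℓ X) ^ 2) +
    2 * condAvg p S h ℓ X (fun u =>
      (ndot n u (condMean p S h ℓ X) - condOverlap p S h ℓ X) ^ 2)

/-- The average of the cavity field for a given Gaussian disorder. -/
def condField (lam : ℝ) (p : ℝ → ℝ) (S : Finset ℝ) (h : (Fin n → ℝ) → ℝ) (ℓ : Fin n → Bool)
    (X : Fin n → ℝ) (G : (Fin (n + 1) → ℝ) × (Fin (n + 1) × Fin (n + 1) → ℝ)) : ℝ :=
  condAvg p S h ℓ X fun u => Real.exp (pdot (yVec lam u) G +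
    (pdot (yVec lam u) (yVec lam X) - pdot (yVec lam u) (yVec lam u) / 2))

lemma abs_sq_sub_sq_le {c K a q δ : ℝ} (hc : 0 ≤ c) (ha : |a| ≤ K) (hq : |q| ≤ K) (hδ : 0 < δ) :
    |c / 2 * a ^ 2 - c / 2 * q ^ 2| ≤ c * K * (δ + (a - q) ^ 2 / δ) := by
  have h1 : |a + q| ≤ 2 * K := (abs_add_le _ _).trans (by linarith)
  have h0 : 0 ≤ K := (abs_nonneg a).trans ha
  have h2 : |a - q| ≤ δ + (a - q) ^ 2 / δ := by
    rw [← sq_abs (a - q), ← sub_nonneg]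
    have : δ + |a - q| ^ 2 / δ - |a - q| = ((|a - q| - δ / 2) ^ 2 + 3 / 4 * δ ^ 2) / δ := by
      field_simp
      ring
    rw [this]
    positivity
  rw [show c / 2 * a ^ 2 - c / 2 * q ^ 2 = c / 2 * ((a + q) * (a - q)) by ring, abs_mul, abs_mul,
    abs_of_nonneg (by positivity : 0 ≤ c / 2)]
  calc _ ≤ c / 2 * (2 * K * (δ + (a - q) ^ 2 / δ)) := by gcongr
    _ = _ := by ring

lemma condAvg_abs_sub_le (hp : ∀ s, 0 ≤ p s) (hS : ∑ s ∈ S, p s = 1) (hh : ∀ u, 0 < h u)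
    (hX : X ∈ confs S n) {f g : (Fin n → ℝ) → ℝ} {c δ q : ℝ}
    (hfg : ∀ u ∈ confs S n, f u ≤ c * (δ + (g u - q) ^ 2 / δ)) :
    condAvg p S h ℓ X f ≤ c * (δ + condAvg p S h ℓ X (fun u => (g u - q) ^ 2) / δ) := by
  refine (condAvg_mono hp hS hh hX hfg).trans (le_of_eq ?_)
  have h1 : (fun u => c * (δ + (g u - q) ^ 2 / δ)) = fun u => c * (δ + δ⁻¹ * (g u - q) ^ 2) := by
    ext u; rw [div_eq_inv_mul]
  rw [h1, condAvg_const_mul, condAvg_add, condAvg_const hp hS hh, condAvg_const_mul, div_eq_inv_mul]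

lemma abs_condOverlap_le (hp : ∀ s, 0 ≤ p s) (hS : ∑ s ∈ S, p s = 1) (hh : ∀ u, 0 < h u)
    {K : ℝ} (hSK : ∀ s ∈ S, |s| ≤ K) (hX : X ∈ confs S n) :
    |condOverlap p S h ℓ X| ≤ K ^ 2 :=
  abs_ndot_le (abs_condMean_le hp hS hh hSK hX) (abs_condMean_le hp hS hh hSK hX)

lemma abs_integral_log_condField_sub_le {lam : ℝ} (hlam : 0 < lam) (hp : ∀ s, 0 ≤ p s)
    (hS : ∑ s ∈ S, p s = 1) (hh : ∀ u, 0 < h u) {K : ℝ} (hSK : ∀ s ∈ S, |s| ≤ K)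
    (hX : X ∈ confs S n) {δ δ' : ℝ} (hδ : 0 < δ) (hδ' : 0 < δ') :
    |∫ G, Real.log (condField lam p S h ℓ X G) ∂stdGaussProd _ _ -
        lam / 4 * condOverlap p S h ℓ X ^ 2| ≤
      δ * (2 * Real.exp (3 * (lam / 2 * K ^ 4))) +
        1 / (2 * δ) * (Real.exp (3 * (lam / 2 * K ^ 4)) *
          (lam * K ^ 2 * (7 * δ' + overlapFluct p S h ℓ X / δ'))) := by
  set b := condMean p S h ℓ X with hb
  set Q := condOverlap p S h ℓ X with hQ
  have hbK : ∀ i, |b i| ≤ K := abs_condMean_le hp hS hh hSK hX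
  have hQK : |Q| ≤ K ^ 2 := abs_condOverlap_le hp hS hh hSK hX
  have hconf : ∀ u ∈ confs S n, ∀ i, |u i| ≤ K := fun u hu i =>
    hSK _ (Fintype.mem_piFinset.1 hu i)
  have hmem : ∀ u w : Fin n → ℝ, (∀ i, |u i| ≤ K) → (∀ i, |w i| ≤ K) →
      pdot (yVec lam u) (yVec lam w) ∈ Set.Icc 0 (lam / 2 * K ^ 4) := by
    intro u w hu hw
    rw [pdot_yVec hlam]
    have h1 := abs_ndot_le hu hw
    have h2 : ndot n u w ^ 2 ≤ K ^ 4 := by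
      rw [← sq_abs, show K ^ 4 = (K ^ 2) ^ 2 by ring]
      gcongr
    exact ⟨by positivity, by gcongr⟩
  have hbb : pdot (yVec lam b) (yVec lam b) = lam / 2 * Q ^ 2 := pdot_yVec hlam b b
  have hdiff : ∀ u w : Fin n → ℝ, (∀ i, |u i| ≤ K) → (∀ i, |w i| ≤ K) →
      |pdot (yVec lam u) (yVec lam w) - pdot (yVec lam b) (yVec lam b)| ≤
        lam * K ^ 2 * (δ' + (ndot n u w - Q) ^ 2 / δ') := by
    intro u w hu hw
    rw [hbb, pdot_yVec hlam]
    exact abs_sq_sub_sq_le hlam.le (abs_ndot_le hu hw) hQK hδ'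
  have hmix : ∀ x ∈ confs S n, ∀ i, |mix ℓ X x i| ≤ K := fun x hx => hconf _ (mix_mem ℓ hX hx)
  have main := abs_integral_log_avg_exp_sub_le (C := confs S n)
    (fun x _ => condWeight_nonneg (h := h) (ℓ := ℓ) (X := X) hp hS hh x) (sum_condWeight hp hS hh)
    (fun x => yVec lam (mix ℓ X x)) (yVec lam X) (yVec lam b) (M := lam / 2 * K ^ 4)
    (fun x hx y hy => hmem _ _ (hmix x hx) (hmix y hy))
    (fun x hx => hmem _ _ (hmix x hx) (hconf X hX)) (fun x hx => hmem _ _ (hmix x hx) hbK)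
    (hmem _ _ hbK hbK) hδ
  have e1 : condAvg p S h ℓ X (fun u => condAvg p S h ℓ X fun w =>
      |pdot (yVec lam u) (yVec lam w) - pdot (yVec lam b) (yVec lam b)|) ≤
      lam * K ^ 2 * (δ' + condAvg p S h ℓ X (fun u => condAvg p S h ℓ X fun v =>
        (ndot n u v - Q) ^ 2) / δ') := by
    refine (condAvg_mono hp hS hh hX fun u hu => condAvg_abs_sub_le hp hS hh hX
      fun w hw => hdiff u w (hconf u hu) (hconf w hw)).trans (le_of_eq ?_)
    simp only [div_eq_inv_mul]
    rw [condAvg_const_mul, condAvg_add, condAvg_const hp hS hh, condAvg_const_mul]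
  have e2 : condAvg p S h ℓ X (fun u =>
      |pdot (yVec lam u) (yVec lam X) - pdot (yVec lam b) (yVec lam b)|) ≤
      lam * K ^ 2 * (δ' + condAvg p S h ℓ X (fun u => (ndot n u X - Q) ^ 2) / δ') :=
    condAvg_abs_sub_le hp hS hh hX fun u hu => hdiff u X (hconf u hu) (hconf X hX)
  have e3 : condAvg p S h ℓ X (fun u =>
      |pdot (yVec lam u) (yVec lam b) - pdot (yVec lam b) (yVec lam b)|) ≤
      lam * K ^ 2 * (δ' + condAvg p S h ℓ X (fun u => (ndot n u b - Q) ^ 2) / δ') :=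
    condAvg_abs_sub_le hp hS hh hX fun u hu => hdiff u b (hconf u hu) hbK
  have hQ4 : pdot (yVec lam b) (yVec lam b) / 2 = lam / 4 * Q ^ 2 := by rw [hbb]; ring
  rw [hQ4] at main
  refine main.trans ?_
  gcongr
  refine (add_le_add (add_le_add e1 (mul_le_mul_of_nonneg_left e2 zero_le_four))
    (mul_le_mul_of_nonneg_left e3 zero_le_two)).trans (le_of_eq ?_)
  rw [overlapFluct]
  ring

lemma exists_abs_integral_log_condField_sub_le {lam K : ℝ} (hlam : 0 < lam) (hK : 0 < K) {η : ℝ}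
    (hη : 0 < η) : ∃ c, 0 ≤ c ∧ ∀ (n : ℕ) (p : ℝ → ℝ) (S : Finset ℝ) (h : (Fin n → ℝ) → ℝ)
      (ℓ : Fin n → Bool) (X : Fin n → ℝ), (∀ s, 0 ≤ p s) → ∑ s ∈ S, p s = 1 → (∀ u, 0 < h u) →
      (∀ s ∈ S, |s| ≤ K) → X ∈ confs S n →
      |∫ G, Real.log (condField lam p S h ℓ X G) ∂stdGaussProd _ _ -
        lam / 4 * condOverlap p S h ℓ X ^ 2| ≤ η + c * overlapFluct p S h ℓ X := by
  set E := Real.exp (3 * (lam / 2 * K ^ 4))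
  have hE : 0 < E := Real.exp_pos _
  set δ := η / (4 * E) with hδ
  set δ' := η * δ / (7 * (E * (lam * K ^ 2))) with hδ'
  have hδ0 : 0 < δ := by positivity
  have hδ'0 : 0 < δ' := by positivity
  refine ⟨1 / (2 * δ) * (E * (lam * K ^ 2 / δ')), by positivity, ?_⟩
  intro n p S h ℓ X hp hS hh hSK hX
  refine (abs_integral_log_condField_sub_le hlam hp hS hh hSK hX hδ0 hδ'0).trans (le_of_eq ?_)
  have h1 : δ * (2 * E) = η / 2 := by rw [hδ]; field_simp; norm_num
  have h2 : 1 / (2 * δ) * (E * (lam * K ^ 2 * (7 * δ'))) = η / 2 := by rw [hδ']; field_simp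
  calc _ = δ * (2 * E) + 1 / (2 * δ) * (E * (lam * K ^ 2 * (7 * δ'))) +
        1 / (2 * δ) * (E * (lam * K ^ 2 / δ')) * overlapFluct p S h ℓ X := by ring
    _ = _ := by rw [h1, h2]; ring

lemma sum_overlapFluct_le (hp : ∀ s, 0 ≤ p s) (hS : ∑ s ∈ S, p s = 1) (hh : ∀ u, 0 < h u)
    {K : ℝ} (hSK : ∀ s ∈ S, |s| ≤ K) :
    ∑ X ∈ confs S n, prodWeight p X * h X * overlapFluct p S h ℓ X ≤
      ∑ X ∈ confs S n, prodWeight p X * h X *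
        (14 * K ^ 2 * ((1 / n : ℝ) ^ 2 * ∑ i, ∑ j, |condCov p S h ℓ X i j|)) := by
  have hN := sum_condAvg (n := n) (ℓ := ℓ) hp hS hh (fun u X => condAvg p S h ℓ X fun v =>
    (ndot n u v - condOverlap p S h ℓ X) ^ 2) fun u X x => by
      have h1 : condOverlap p S h ℓ (mix ℓ X x) = condOverlap p S h ℓ X := by
        have : condMean p S h ℓ (mix ℓ X x) = condMean p S h ℓ X :=
          funext fun i => condAvg_mix (fun _ => id) X x _
        rw [condOverlap, condOverlap, this]
      rw [h1, condAvg_mix fun _ => id]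
  have h2 : ∑ X ∈ confs S n, prodWeight p X * h X * overlapFluct p S h ℓ X =
      ∑ X ∈ confs S n, prodWeight p X * h X * (5 * condAvg p S h ℓ X (fun u =>
        condAvg p S h ℓ X fun v => (ndot n u v - condOverlap p S h ℓ X) ^ 2) +
        2 * condAvg p S h ℓ X (fun u =>
          (ndot n u (condMean p S h ℓ X) - condOverlap p S h ℓ X) ^ 2)) := by
    simp only [overlapFluct, mul_add, sum_add_distrib, mul_left_comm _ (4 : ℝ),
      mul_left_comm _ (5 : ℝ), mul_left_comm _ (2 : ℝ), ← mul_sum]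
    rw [hN]
    simp only [ndot_comm _ _]
    ring
  rw [h2]
  refine sum_le_sum fun X hX => mul_le_mul_of_nonneg_left ?_
    (mul_nonneg (prodWeight_nonneg hp X) (hh X).le)
  have e1 := condAvg_condAvg_ndot_le (ℓ := ℓ) hp hS hh hSK hX
  have e2 := condAvg_ndot_condMean_le (ℓ := ℓ) hp hS hh hSK hX
  have e3 : ∀ u, ndot n (condMean p S h ℓ X) u = ndot n u (condMean p S h ℓ X) := fun u =>
    ndot_comm _ _
  simp only [e3] at e2
  simp only [condOverlap]
  linarith

end overlap

section disorder

variable {n : ℕ} {p : ℝ → ℝ} {S : Finset ℝ} {ℓ : Fin n → Bool} {X : Fin n → ℝ}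

/-- The law of the Gaussian disorder. -/
abbrev disorder (n : ℕ) : Measure (Fin (n + 1) × Fin (n + 1) → ℝ) :=
  stdGaussPi (Fin (n + 1) × Fin (n + 1))

lemma measurable_likelihood (lam : ℝ) (u : Fin n → ℝ) :
    Measurable fun Y => likelihood lam Y u := by
  unfold likelihood dotProduct; fun_prop

lemma integrable_likelihood (lam : ℝ) (u : Fin n → ℝ) :
    Integrable (fun Y => likelihood lam Y u) (disorder n) := by
  simp only [likelihood, sub_eq_add_neg, Real.exp_add]
  exact (integrable_exp_dotProduct _).mul_const _

lemma integral_likelihood (lam : ℝ) (u : Fin n → ℝ) :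
    ∫ Y, likelihood lam Y u ∂disorder n = 1 := by
  simp only [likelihood, sub_eq_add_neg, Real.exp_add]
  rw [integral_mul_const, integral_exp_dotProduct, ← Real.exp_add, add_neg_cancel, Real.exp_zero]

lemma integrable_likelihood_mul (lam : ℝ) (u : Fin n → ℝ)
    {φ : (Fin (n + 1) × Fin (n + 1) → ℝ) → ℝ} (hφ : Measurable φ) {M : ℝ}
    (hM : ∀ Y, |φ Y| ≤ M) : Integrable (fun Y => likelihood lam Y u * φ Y) (disorder n) :=
  (integrable_likelihood lam u).mul_bdd hφ.aestronglyMeasurable (Eventually.of_forall hM)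

lemma measurable_condAvg {β : Type*} [MeasurableSpace β] {h f : β → (Fin n → ℝ) → ℝ}
    (hh : ∀ u, Measurable fun y => h y u) (hf : ∀ u, Measurable fun y => f y u) :
    Measurable fun y => condAvg p S (h y) ℓ X (f y) := by
  unfold condAvg condNorm; fun_prop

lemma measurable_condCov (lam : ℝ) (i j : Fin n) :
    Measurable fun Y => condCov p S (likelihood lam Y) ℓ X i j := by
  have h1 : ∀ f : (Fin n → ℝ) → ℝ, Measurable fun Y => condAvg p S (likelihood lam Y) ℓ X f :=
    fun f => measurable_condAvg (measurable_likelihood lam) fun _ => measurable_const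
  exact (h1 _).sub ((h1 _).mul (h1 _))

lemma measurable_condMean (lam : ℝ) (i : Fin n) :
    Measurable fun Y => condMean p S (likelihood lam Y) ℓ X i :=
  measurable_condAvg (measurable_likelihood lam) fun _ => measurable_const

lemma measurable_condOverlap (lam : ℝ) :
    Measurable fun Y => condOverlap p S (likelihood lam Y) ℓ X := by
  have := measurable_condMean (p := p) (S := S) (ℓ := ℓ) (X := X) lam
  unfold condOverlap ndot; fun_prop

lemma measurable_condField (lam : ℝ) :
    Measurable fun q : (Fin (n + 1) × Fin (n + 1) → ℝ) ×
      ((Fin (n + 1) → ℝ) × (Fin (n + 1) × Fin (n + 1) → ℝ)) =>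
      condField lam p S (likelihood lam q.1) ℓ X q.2 :=
  measurable_condAvg (fun u => (measurable_likelihood lam u).comp measurable_fst) fun u =>
    (((measurable_pdot (yVec lam u)).comp measurable_snd).add_const _).exp

lemma integrable_log_condField (hp : ∀ s, 0 ≤ p s) (hS : ∑ s ∈ S, p s = 1) (lam : ℝ)
    (a : Fin (n + 1) × Fin (n + 1) → ℝ) :
    Integrable (fun q : (Fin (n + 1) × Fin (n + 1) → ℝ) ×
      ((Fin (n + 1) → ℝ) × (Fin (n + 1) × Fin (n + 1) → ℝ)) =>
      Real.log (condField lam p S (likelihood lam (q.1 + a)) ℓ X q.2))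
      ((disorder n).prod (stdGaussProd _ _)) := by
  have h1 : Integrable (fun G => ∑ x ∈ confs S n, |pdot (yVec lam (mix ℓ X x)) G +
      (pdot (yVec lam (mix ℓ X x)) (yVec lam X) -
        pdot (yVec lam (mix ℓ X x)) (yVec lam (mix ℓ X x)) / 2)|) (stdGaussProd _ _) :=
    integrable_finsetSum _ fun x _ => ((integrable_pdot _).add (integrable_const _)).abs
  refine (h1.comp_snd (disorder n)).mono' ?_ (Eventually.of_forall fun q => ?_)
  · exact (Real.measurable_log.comp ((measurable_condField lam).comp
      ((measurable_fst.add_const a).prodMk measurable_snd))).aestronglyMeasurable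
  · exact abs_log_avg_exp_le (fun x _ => condWeight_nonneg hp hS (likelihood_pos lam _) x)
      (sum_condWeight hp hS (likelihood_pos lam _)) _

/-- The mean of the logarithm of the averaged cavity field, given the revealed indices. -/
def fieldMean (lam : ℝ) (p : ℝ → ℝ) (S : Finset ℝ) (ℓ : Fin n → Bool) : ℝ :=
  ∑ X ∈ confs S n, prodWeight p X * ∫ Z, ∫ G, Real.log
    (condField lam p S (likelihood lam (Z + hVec lam X)) ℓ X G) ∂stdGaussProd _ _ ∂disorder n

/-- The mean of the squared overlap, given the revealed indices. -/
def overlapMean (lam : ℝ) (p : ℝ → ℝ) (S : Finset ℝ) (ℓ : Fin n → Bool) : ℝ :=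
  ∑ X ∈ confs S n, prodWeight p X *
    ∫ Z, condOverlap p S (likelihood lam (Z + hVec lam X)) ℓ X ^ 2 ∂disorder n

/-- The mean of `f X Y` over the joint law of signal `X` and observation `Y`. -/
def jointMean (lam : ℝ) (p : ℝ → ℝ) (S : Finset ℝ)
    (f : (Fin n → ℝ) → (Fin (n + 1) × Fin (n + 1) → ℝ) → ℝ) : ℝ :=
  ∫ Y, ∑ X ∈ confs S n, prodWeight p X * likelihood lam Y X * f X Y ∂disorder n

/-- The averaged squares of the conditional covariances, given the revealed indices. -/
def covMean (lam : ℝ) (p : ℝ → ℝ) (S : Finset ℝ) (ℓ : Fin n → Bool) : ℝ :=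
  jointMean lam p S fun X Y =>
    (1 / n : ℝ) ^ 2 * ∑ i, ∑ j, condCov p S (likelihood lam Y) ℓ X i j ^ 2

lemma integrable_jointMean {lam : ℝ} {f : (Fin n → ℝ) → (Fin (n + 1) × Fin (n + 1) → ℝ) → ℝ}
    (hf : ∀ X, Measurable (f X)) {M : ℝ} (hM : ∀ X ∈ confs S n, ∀ Y, |f X Y| ≤ M) :
    Integrable (fun Y => ∑ X ∈ confs S n, prodWeight p X * likelihood lam Y X * f X Y)
      (disorder n) := by
  refine integrable_finsetSum _ fun X hX => ?_
  simp only [mul_assoc]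
  exact (integrable_likelihood_mul lam X (hf X) (hM X hX)).const_mul _

lemma jointMean_const (hS : ∑ s ∈ S, p s = 1) (lam c : ℝ) :
    jointMean lam p S (fun (_ : Fin n → ℝ) _ => c) = c := by
  rw [jointMean, integral_finsetSum _ fun X _ =>
    ((integrable_likelihood lam X).const_mul _).mul_const _]
  simp only [integral_mul_const, integral_const_mul, integral_likelihood, mul_one]
  rw [← sum_mul, sum_prodWeight hS, one_mul]

lemma sum_integral_add_eq_jointMean {lam : ℝ}
    {f : (Fin n → ℝ) → (Fin (n + 1) × Fin (n + 1) → ℝ) → ℝ}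
    (hf : ∀ X, Measurable (f X)) {M : ℝ} (hM : ∀ X ∈ confs S n, ∀ Y, |f X Y| ≤ M) :
    ∑ X ∈ confs S n, prodWeight p X * ∫ Z, f X (Z + hVec lam X) ∂disorder n =
      jointMean lam p S f := by
  have h1 : ∀ X ∈ confs S n, Integrable (fun Y => prodWeight p X * likelihood lam Y X * f X Y)
      (disorder n) := fun X hX => by
    simp only [mul_assoc]
    exact (integrable_likelihood_mul lam X (hf X) (hM X hX)).const_mul _
  rw [jointMean, integral_finsetSum _ h1]
  refine sum_congr rfl fun X _ => ?_
  simp only [mul_assoc]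
  rw [integral_const_mul, integral_add_stdGaussPi]
  rfl

end disorder

section comparisonMean

variable {n : ℕ} {p : ℝ → ℝ} {S : Finset ℝ} {h : (Fin n → ℝ) → ℝ} {ℓ : Fin n → Bool}
  {X : Fin n → ℝ}

lemma abs_overlapFluct_le (hp : ∀ s, 0 ≤ p s) (hS : ∑ s ∈ S, p s = 1) (hh : ∀ u, 0 < h u)
    {K : ℝ} (hSK : ∀ s ∈ S, |s| ≤ K) (hX : X ∈ confs S n) :
    |overlapFluct p S h ℓ X| ≤ 28 * K ^ 4 := by
  have hQ := abs_condOverlap_le (ℓ := ℓ) hp hS hh hSK hX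
  have hconf : ∀ u ∈ confs S n, ∀ i, |u i| ≤ K := fun u hu i =>
    hSK _ (Fintype.mem_piFinset.1 hu i)
  have h1 : ∀ u v : Fin n → ℝ, (∀ i, |u i| ≤ K) → (∀ i, |v i| ≤ K) →
      |(ndot n u v - condOverlap p S h ℓ X) ^ 2| ≤ 4 * K ^ 4 := by
    intro u v hu hv
    have h2 := (abs_sub _ _).trans (add_le_add (abs_ndot_le hu hv) hQ)
    rw [abs_pow]
    calc _ ≤ (K ^ 2 + K ^ 2) ^ 2 := by gcongr
      _ = _ := by ring
  have e1 := abs_condAvg_le hp hS hh (ℓ := ℓ) hX fun u hu => abs_condAvg_le hp hS hh (ℓ := ℓ) hX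
    fun v hv => h1 u v (hconf u hu) (hconf v hv)
  have e2 := abs_condAvg_le hp hS hh (ℓ := ℓ) hX fun u hu => h1 u X (hconf u hu) (hconf X hX)
  have e3 := abs_condAvg_le hp hS hh (ℓ := ℓ) hX fun u hu =>
    h1 u (condMean p S h ℓ X) (hconf u hu) (abs_condMean_le hp hS hh hSK hX)
  rw [abs_le] at *
  unfold overlapFluct
  constructor <;> linarith

lemma abs_condCov_le (hp : ∀ s, 0 ≤ p s) (hS : ∑ s ∈ S, p s = 1) (hh : ∀ u, 0 < h u)
    {K : ℝ} (hSK : ∀ s ∈ S, |s| ≤ K) (hX : X ∈ confs S n) (i j : Fin n) :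
    |condCov p S h ℓ X i j| ≤ 2 * K ^ 2 := by
  have hconf : ∀ u ∈ confs S n, ∀ i, |u i| ≤ K := fun u hu i =>
    hSK _ (Fintype.mem_piFinset.1 hu i)
  have e1 := abs_condAvg_le hp hS hh (ℓ := ℓ) hX (f := fun u => u i * u j) fun u hu =>
    abs_mul_le_sq (hconf u hu i) (hconf u hu j)
  have e2 := abs_mul_le_sq (abs_condMean_le hp hS hh hSK (ℓ := ℓ) hX i)
    (abs_condMean_le hp hS hh hSK (ℓ := ℓ) hX j)
  refine (abs_sub _ _).trans ((add_le_add e1 e2).trans (le_of_eq ?_))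
  ring

lemma measurable_avg_condCov_sq (lam : ℝ) :
    Measurable fun Y =>
      (1 / n : ℝ) ^ 2 * ∑ i, ∑ j, condCov p S (likelihood lam Y) ℓ X i j ^ 2 :=
  (Finset.measurable_sum _ fun i _ => Finset.measurable_sum _ fun j _ =>
    (measurable_condCov lam i j).pow_const 2).const_mul _

lemma inv_sq_mul_sum_sum_const_le (c : ℝ) (hc : 0 ≤ c) :
    (1 / n : ℝ) ^ 2 * ∑ _i : Fin n, ∑ _j : Fin n, c ≤ c := by
  rcases Nat.eq_zero_or_pos n with rfl | hn
  · simpa using hc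
  · have : (n : ℝ) ≠ 0 := by positivity
    simp only [sum_const, card_univ, Fintype.card_fin, nsmul_eq_mul]
    refine le_of_eq ?_
    field_simp

lemma abs_avg_condCov_sq_le (hp : ∀ s, 0 ≤ p s) (hS : ∑ s ∈ S, p s = 1) (hh : ∀ u, 0 < h u)
    {K : ℝ} (hSK : ∀ s ∈ S, |s| ≤ K) (hX : X ∈ confs S n) :
    |(1 / n : ℝ) ^ 2 * ∑ i, ∑ j, condCov p S h ℓ X i j ^ 2| ≤ (2 * K ^ 2) ^ 2 := by
  rw [abs_of_nonneg (by positivity)]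
  refine le_trans ?_ (inv_sq_mul_sum_sum_const_le (n := n) ((2 * K ^ 2) ^ 2) (by positivity))
  refine mul_le_mul_of_nonneg_left (sum_le_sum fun i _ => sum_le_sum fun j _ => ?_) (by positivity)
  rw [← sq_abs (condCov _ _ _ _ _ _ _)]
  gcongr
  exact abs_condCov_le hp hS hh hSK hX i j

lemma avg_abs_condCov_le {δ : ℝ} (hδ : 0 < δ) :
    (1 / n : ℝ) ^ 2 * ∑ i, ∑ j, |condCov p S h ℓ X i j| ≤
      δ + 1 / δ * ((1 / n : ℝ) ^ 2 * ∑ i, ∑ j, condCov p S h ℓ X i j ^ 2) := by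
  have h1 : ∀ t : ℝ, |t| ≤ δ + 1 / δ * t ^ 2 := fun t => by
    rw [← sq_abs t, ← sub_nonneg]
    have : δ + 1 / δ * |t| ^ 2 - |t| = ((|t| - δ / 2) ^ 2 + 3 / 4 * δ ^ 2) / δ := by
      field_simp
      ring
    rw [this]
    positivity
  calc _ ≤ (1 / n : ℝ) ^ 2 * ∑ i : Fin n, ∑ j : Fin n, (δ + 1 / δ * condCov p S h ℓ X i j ^ 2) := by
        gcongr with i _ j _
        exact h1 _
    _ = (1 / n : ℝ) ^ 2 * ∑ _i : Fin n, ∑ _j : Fin n, δ +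
        1 / δ * ((1 / n : ℝ) ^ 2 * ∑ i, ∑ j, condCov p S h ℓ X i j ^ 2) := by
        simp only [sum_add_distrib, ← mul_sum]
        ring
    _ ≤ _ := by
        gcongr
        exact inv_sq_mul_sum_sum_const_le δ hδ.le

lemma exists_abs_fieldMean_sub_le {lam K : ℝ} (hlam : 0 < lam) (hK : 0 < K) {η : ℝ}
    (hη : 0 < η) : ∃ C, 0 ≤ C ∧ ∀ (n : ℕ) (p : ℝ → ℝ) (S : Finset ℝ) (ℓ : Fin n → Bool),
      (∀ s, 0 ≤ p s) → ∑ s ∈ S, p s = 1 → (∀ s ∈ S, |s| ≤ K) →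
      |fieldMean lam p S ℓ - lam / 4 * overlapMean lam p S ℓ| ≤ η + C * covMean lam p S ℓ := by
  obtain ⟨c, hc, hpt⟩ := exists_abs_integral_log_condField_sub_le hlam hK (half_pos hη)
  set δ := η / (2 * (14 * K ^ 2 * c + 1)) with hδ
  have hδ0 : 0 < δ := by positivity
  have hδη : c * (14 * K ^ 2 * δ) ≤ η / 2 := by
    rw [hδ, ← sub_nonneg]
    have : η / 2 - c * (14 * K ^ 2 * (η / (2 * (14 * K ^ 2 * c + 1)))) =
        η / (2 * (14 * K ^ 2 * c + 1)) := by
      field_simp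
      ring
    rw [this]
    positivity
  refine ⟨c * (14 * K ^ 2) / δ, by positivity, ?_⟩
  intro n p S ℓ hp hS hSK
  have hl := likelihood_pos (n := n) lam
  set f₀ : (Fin n → ℝ) → (Fin (n + 1) × Fin (n + 1) → ℝ) → ℝ := fun X Y =>
    ∫ G, Real.log (condField lam p S (likelihood lam Y) ℓ X G) ∂stdGaussProd _ _ with hf₀
  set f₁ : (Fin n → ℝ) → (Fin (n + 1) × Fin (n + 1) → ℝ) → ℝ := fun X Y =>
    condOverlap p S (likelihood lam Y) ℓ X ^ 2 with hf₁
  set f₂ : (Fin n → ℝ) → (Fin (n + 1) × Fin (n + 1) → ℝ) → ℝ := fun X Y =>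
    (1 / n : ℝ) ^ 2 * ∑ i, ∑ j, condCov p S (likelihood lam Y) ℓ X i j ^ 2 with hf₂
  have hm₀ : ∀ X, Measurable (f₀ X) := fun X =>
    (Real.measurable_log.comp (measurable_condField lam)).stronglyMeasurable.integral_prod_right'
      |>.measurable
  have hm₁ : ∀ X, Measurable (f₁ X) := fun X => (measurable_condOverlap lam).pow_const 2
  have hm₂ : ∀ X, Measurable (f₂ X) := fun X => measurable_avg_condCov_sq lam
  have hd : ∀ X ∈ confs S n, ∀ Y, |f₀ X Y - lam / 4 * f₁ X Y| ≤
      η / 2 + c * overlapFluct p S (likelihood lam Y) ℓ X := fun X hX Y =>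
    hpt n p S _ ℓ X hp hS (hl Y) hSK hX
  have hb₁ : ∀ X ∈ confs S n, ∀ Y, |f₁ X Y| ≤ (K ^ 2) ^ 2 := fun X hX Y => by
    rw [hf₁, abs_pow]
    gcongr
    exact abs_condOverlap_le hp hS (hl Y) hSK hX
  have hb₂ : ∀ X ∈ confs S n, ∀ Y, |f₂ X Y| ≤ (2 * K ^ 2) ^ 2 := fun X hX Y =>
    abs_avg_condCov_sq_le hp hS (hl Y) hSK hX
  have hb₀ : ∀ X ∈ confs S n, ∀ Y, |f₀ X Y| ≤
      η / 2 + c * (28 * K ^ 4) + lam / 4 * (K ^ 2) ^ 2 := fun X hX Y => by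
    have h1 := (hd X hX Y).trans (add_le_add_right (mul_le_mul_of_nonneg_left
      ((le_abs_self _).trans (abs_overlapFluct_le hp hS (hl Y) hSK hX)) hc) (η / 2))
    have h2 : |lam / 4 * f₁ X Y| ≤ lam / 4 * (K ^ 2) ^ 2 := by
      rw [abs_mul, abs_of_nonneg (by positivity : 0 ≤ lam / 4)]
      gcongr
      exact hb₁ X hX Y
    calc _ = |(f₀ X Y - lam / 4 * f₁ X Y) + lam / 4 * f₁ X Y| := by rw [sub_add_cancel]
      _ ≤ _ := (abs_add_le _ _).trans (add_le_add h1 h2)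
  have hA : fieldMean lam p S ℓ = jointMean lam p S f₀ := sum_integral_add_eq_jointMean hm₀ hb₀
  have hB : overlapMean lam p S ℓ = jointMean lam p S f₁ := sum_integral_add_eq_jointMean hm₁ hb₁
  have hi₀ := integrable_jointMean (p := p) (lam := lam) hm₀ hb₀
  have hi₁ := integrable_jointMean (p := p) (lam := lam) hm₁ hb₁
  have hi₂ := integrable_jointMean (p := p) (lam := lam) hm₂ hb₂
  have hi := integrable_jointMean (p := p) (S := S) (n := n) (lam := lam) (f := fun _ _ => η)
    (fun _ => measurable_const) (fun _ _ _ => le_refl |η|)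
  have hη1 : jointMean lam p S (fun (_ : Fin n → ℝ) _ => η) = η := jointMean_const hS lam η
  rw [hA, hB]
  calc |jointMean lam p S f₀ - lam / 4 * jointMean lam p S f₁| =
      |∫ Y, (∑ X ∈ confs S n, prodWeight p X * likelihood lam Y X * f₀ X Y -
        lam / 4 * ∑ X ∈ confs S n, prodWeight p X * likelihood lam Y X * f₁ X Y) ∂disorder n| := by
        rw [integral_sub hi₀ (hi₁.const_mul _), integral_const_mul, jointMean, jointMean]
    _ ≤ ∫ Y, |∑ X ∈ confs S n, prodWeight p X * likelihood lam Y X * f₀ X Y -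
        lam / 4 * ∑ X ∈ confs S n, prodWeight p X * likelihood lam Y X * f₁ X Y| ∂disorder n :=
        abs_integral_le_integral_abs
    _ ≤ ∫ Y, (∑ X ∈ confs S n, prodWeight p X * likelihood lam Y X * η +
        c * (14 * K ^ 2) / δ * ∑ X ∈ confs S n, prodWeight p X * likelihood lam Y X * f₂ X Y)
        ∂disorder n := by
        refine integral_mono (hi₀.sub (hi₁.const_mul _)).abs (hi.add (hi₂.const_mul _)) fun Y => ?_
        have hw : ∀ X, 0 ≤ prodWeight p X * likelihood lam Y X := fun X =>
          mul_nonneg (prodWeight_nonneg hp X) (hl Y X).le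
        calc _ = |∑ X ∈ confs S n, prodWeight p X * likelihood lam Y X *
              (f₀ X Y - lam / 4 * f₁ X Y)| := by
              rw [mul_sum, ← sum_sub_distrib]
              congr 1
              exact sum_congr rfl fun X _ => by ring
          _ ≤ ∑ X ∈ confs S n, prodWeight p X * likelihood lam Y X *
              (η / 2 + c * overlapFluct p S (likelihood lam Y) ℓ X) := by
              refine (abs_sum_le_sum_abs _ _).trans (sum_le_sum fun X hX => ?_)
              rw [abs_mul, abs_of_nonneg (hw X)]
              exact mul_le_mul_of_nonneg_left (hd X hX Y) (hw X)
          _ = ∑ X ∈ confs S n, prodWeight p X * likelihood lam Y X * (η / 2) +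
              c * ∑ X ∈ confs S n, prodWeight p X * likelihood lam Y X *
                overlapFluct p S (likelihood lam Y) ℓ X := by
              rw [mul_sum, ← sum_add_distrib]
              exact sum_congr rfl fun X _ => by ring
          _ ≤ ∑ X ∈ confs S n, prodWeight p X * likelihood lam Y X * (η / 2) +
              c * ∑ X ∈ confs S n, prodWeight p X * likelihood lam Y X *
                (14 * K ^ 2 * ((1 / n : ℝ) ^ 2 *
                  ∑ i, ∑ j, |condCov p S (likelihood lam Y) ℓ X i j|)) := by
              exact add_le_add_right (mul_le_mul_of_nonneg_left
                (sum_overlapFluct_le hp hS (hl Y) hSK) hc) _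
          _ ≤ ∑ X ∈ confs S n, prodWeight p X * likelihood lam Y X * (η / 2) +
              c * ∑ X ∈ confs S n, prodWeight p X * likelihood lam Y X *
                (14 * K ^ 2 * (δ + 1 / δ * f₂ X Y)) := by
              gcongr with X hX
              · exact hw X
              · exact avg_abs_condCov_le hδ0
          _ = ∑ X ∈ confs S n, prodWeight p X * likelihood lam Y X *
                (η / 2 + c * (14 * K ^ 2 * δ)) + c * (14 * K ^ 2) / δ *
              ∑ X ∈ confs S n, prodWeight p X * likelihood lam Y X * f₂ X Y := by
              rw [mul_sum, mul_sum, ← sum_add_distrib, ← sum_add_distrib]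
              exact sum_congr rfl fun X _ => by ring
          _ ≤ _ := by
              gcongr with X hX
              · exact hw X
              · linarith
    _ = jointMean lam p S (fun (_ : Fin n → ℝ) _ => η) +
        c * (14 * K ^ 2) / δ * jointMean lam p S f₂ := by
        rw [integral_add hi (hi₂.const_mul _), integral_const_mul, jointMean, jointMean]
    _ = _ := by rw [hη1]; rfl

end comparisonMean

section pinning

variable {n : ℕ} {p : ℝ → ℝ} {S : Finset ℝ} {ℓ : Fin n → Bool}

/-- The sum of the conditional variances, given the revealed indices. -/
def varMean (lam : ℝ) (p : ℝ → ℝ) (S : Finset ℝ) (ℓ : Fin n → Bool) : ℝ :=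
  jointMean lam p S fun X Y => ∑ i, condCov p S (likelihood lam Y) ℓ X i i

lemma measurable_sum_condCov (lam : ℝ) (X : Fin n → ℝ) :
    Measurable fun Y => ∑ i, condCov p S (likelihood lam Y) ℓ X i i :=
  Finset.measurable_sum _ fun i _ => measurable_condCov lam i i

lemma abs_sum_condCov_le (hp : ∀ s, 0 ≤ p s) (hS : ∑ s ∈ S, p s = 1) (lam : ℝ) {K : ℝ}
    (hSK : ∀ s ∈ S, |s| ≤ K) (X : Fin n → ℝ) (hX : X ∈ confs S n)
    (Y : Fin (n + 1) × Fin (n + 1) → ℝ) :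
    |∑ i, condCov p S (likelihood lam Y) ℓ X i i| ≤ n * K ^ 2 := by
  rw [abs_of_nonneg (sum_nonneg fun i _ => condCov_self_nonneg hp hS (likelihood_pos lam Y) i)]
  refine (sum_le_sum fun i _ =>
    condCov_self_le hp hS (likelihood_pos lam Y) hSK hX i).trans (le_of_eq ?_)
  simp

lemma varMean_nonneg (hp : ∀ s, 0 ≤ p s) (hS : ∑ s ∈ S, p s = 1) (lam : ℝ) :
    0 ≤ varMean lam p S ℓ :=
  integral_nonneg fun Y => sum_nonneg fun X _ => mul_nonneg
    (mul_nonneg (prodWeight_nonneg hp X) (likelihood_pos lam Y X).le)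
    (sum_nonneg fun i _ => condCov_self_nonneg hp hS (likelihood_pos lam Y) i)

lemma varMean_le (hp : ∀ s, 0 ≤ p s) (hS : ∑ s ∈ S, p s = 1) (lam : ℝ) {K : ℝ}
    (hSK : ∀ s ∈ S, |s| ≤ K) : varMean lam p S ℓ ≤ n * K ^ 2 := by
  rw [← jointMean_const (n := n) hS lam (n * K ^ 2), varMean, jointMean, jointMean]
  refine integral_mono (integrable_jointMean (measurable_sum_condCov lam)
    (abs_sum_condCov_le hp hS lam hSK)) (integrable_jointMean (fun _ => measurable_const)
      fun _ _ _ => le_refl _) fun Y => sum_le_sum fun X hX => ?_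
  exact mul_le_mul_of_nonneg_left ((le_abs_self _).trans (abs_sum_condCov_le hp hS lam hSK X hX Y))
    (mul_nonneg (prodWeight_nonneg hp X) (likelihood_pos lam Y X).le)

/-- Revealing one more index decreases the conditional variances by at least the squared
conditional covariances with that index. -/
lemma jointMean_condCov_sq_le (hp : ∀ s, 0 ≤ p s) (hS : ∑ s ∈ S, p s = 1) (lam : ℝ) {K : ℝ}
    (hK : 0 < K) (hSK : ∀ s ∈ S, |s| ≤ K) (j : Fin n) :
    jointMean lam p S (fun X Y => ∑ i, condCov p S (likelihood lam Y) ℓ X i j ^ 2) ≤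
      K ^ 2 * (varMean lam p S ℓ - varMean lam p S (Function.update ℓ j true)) := by
  have hi : ∀ ℓ : Fin n → Bool, Integrable (fun Y => ∑ X ∈ confs S n, prodWeight p X *
      likelihood lam Y X * ∑ i, condCov p S (likelihood lam Y) ℓ X i i) (disorder n) := fun ℓ =>
    integrable_jointMean (measurable_sum_condCov lam) (abs_sum_condCov_le hp hS lam hSK)
  rw [varMean, varMean, jointMean, jointMean, jointMean, ← integral_sub (hi _) (hi _),
    ← integral_const_mul]
  refine integral_mono_of_nonneg (Eventually.of_forall fun Y => sum_nonneg fun X _ => mul_nonneg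
    (mul_nonneg (prodWeight_nonneg hp X) (likelihood_pos lam Y X).le)
    (sum_nonneg fun i _ => sq_nonneg _)) (((hi _).sub (hi _)).const_mul _)
    (Eventually.of_forall fun Y => ?_)
  have hsum : ∀ g : (Fin n → ℝ) → Fin n → ℝ, ∑ X ∈ confs S n, prodWeight p X *
      likelihood lam Y X * ∑ i, g X i =
      ∑ i, ∑ X ∈ confs S n, prodWeight p X * likelihood lam Y X * g X i := fun g => by
    rw [sum_comm]
    simp only [mul_sum]
  simp only [hsum, ← sum_sub_distrib (s := univ)]
  rw [mul_sum]
  exact sum_le_sum fun i _ => sum_condCov_sq_le hp hS (likelihood_pos lam Y) hK hSK i j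

lemma covMean_le (hp : ∀ s, 0 ≤ p s) (hS : ∑ s ∈ S, p s = 1) (lam : ℝ) {K : ℝ}
    (hK : 0 < K) (hSK : ∀ s ∈ S, |s| ≤ K) :
    covMean lam p S ℓ ≤ (1 / n : ℝ) ^ 2 * (K ^ 2 * ∑ j,
      (varMean lam p S (Function.update ℓ j false) -
        varMean lam p S (Function.update ℓ j true))) := by
  have hnonneg : ∀ (ℓ : Fin n → Bool) j, 0 ≤ jointMean lam p S
      (fun X Y => ∑ i, condCov p S (likelihood lam Y) ℓ X i j ^ 2) := fun ℓ j =>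
    integral_nonneg fun Y => sum_nonneg fun X _ => mul_nonneg
      (mul_nonneg (prodWeight_nonneg hp X) (likelihood_pos lam Y X).le)
      (sum_nonneg fun i _ => sq_nonneg _)
  have hmono : ∀ j, varMean lam p S ℓ ≤ varMean lam p S (Function.update ℓ j false) := by
    intro j
    cases hj : ℓ j
    · rw [← hj, Function.update_eq_self]
    · have h1 := (hnonneg (Function.update ℓ j false) j).trans
        (jointMean_condCov_sq_le hp hS lam hK hSK j)
      rw [Function.update_idem, ← hj, Function.update_eq_self] at h1
      exact sub_nonneg.1 (nonneg_of_mul_nonneg_right h1 (by positivity))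
  have heq : covMean lam p S ℓ = (1 / n : ℝ) ^ 2 * ∑ j, jointMean lam p S
      (fun X Y => ∑ i, condCov p S (likelihood lam Y) ℓ X i j ^ 2) := by
    simp only [covMean, jointMean]
    rw [← integral_finsetSum, ← integral_const_mul]
    · congr 1
      ext Y
      rw [sum_comm, mul_sum]
      refine sum_congr rfl fun X _ => ?_
      rw [← mul_sum, sum_comm]
      ring
    · intro j _
      refine integrable_jointMean (M := n * (2 * K ^ 2) ^ 2) (fun X =>
        Finset.measurable_sum _ fun i _ => (measurable_condCov lam i j).pow_const 2)
        fun X hX Y => ?_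
      rw [abs_of_nonneg (sum_nonneg fun i _ => sq_nonneg _)]
      calc _ ≤ ∑ i : Fin n, (2 * K ^ 2) ^ 2 := sum_le_sum fun i _ => by
            rw [← sq_abs (condCov _ _ _ _ _ _ _)]
            have := abs_condCov_le hp hS (likelihood_pos lam Y) hSK (ℓ := ℓ) hX i j
            gcongr
        _ = _ := by simp
  rw [heq]
  refine mul_le_mul_of_nonneg_left ?_ (by positivity)
  rw [mul_sum]
  refine sum_le_sum fun j _ => ?_
  refine (jointMean_condCov_sq_le hp hS lam hK hSK j).trans ?_
  gcongr
  exact hmono j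

end pinning

section russo

/-- The probability of `b` under the Bernoulli law of parameter `ε`. -/
def bernProb (ε : ℝ) (b : Bool) : ℝ := if b then ε else 1 - ε

/-- The probability of `ℓ` under the product Bernoulli law of parameter `ε`. -/
def bernWeight {n : ℕ} (ε : ℝ) (ℓ : Fin n → Bool) : ℝ := ∏ i, bernProb ε (ℓ i)

lemma bernProb_nonneg {ε : ℝ} (h0 : 0 ≤ ε) (h1 : ε ≤ 1) (b : Bool) : 0 ≤ bernProb ε b := by
  cases b <;> simp [bernProb, h0, h1]

lemma bernWeight_nonneg {n : ℕ} {ε : ℝ} (h0 : 0 ≤ ε) (h1 : ε ≤ 1) (ℓ : Fin n → Bool) :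
    0 ≤ bernWeight ε ℓ := prod_nonneg fun _ _ => bernProb_nonneg h0 h1 _

lemma sum_bernWeight (n : ℕ) (ε : ℝ) : ∑ ℓ : Fin n → Bool, bernWeight ε ℓ = 1 := by
  have := (prod_univ_sum (fun _ : Fin n => (univ : Finset Bool)) fun _ b => bernProb ε b).symm
  rw [Fintype.piFinset_univ] at this
  simpa [bernWeight, bernProb] using this

lemma hasDerivAt_bernProb (ε : ℝ) (b : Bool) :
    HasDerivAt (fun ε => bernProb ε b) (if b then 1 else -1) ε := by
  cases b
  · simpa [bernProb] using (hasDerivAt_id ε).const_sub 1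
  · simpa [bernProb] using hasDerivAt_id' ε

lemma continuous_bernWeight {n : ℕ} (ℓ : Fin n → Bool) :
    Continuous fun ε => bernWeight ε ℓ :=
  continuous_finsetProd _ fun i _ =>
    continuous_iff_continuousAt.2 fun ε => (hasDerivAt_bernProb ε (ℓ i)).continuousAt

/-- The Margulis–Russo formula. -/
lemma hasDerivAt_sum_bernWeight {n : ℕ} (Φ : (Fin n → Bool) → ℝ) (ε : ℝ) :
    HasDerivAt (fun ε => ∑ ℓ, bernWeight ε ℓ * Φ ℓ)
      (∑ ℓ, bernWeight ε ℓ * ∑ j, (Φ (Function.update ℓ j true) -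
        Φ (Function.update ℓ j false))) ε := by
  have h1 : HasDerivAt (fun ε => ∑ ℓ, bernWeight ε ℓ * Φ ℓ)
      (∑ ℓ : Fin n → Bool, (∑ j, (∏ i ∈ univ.erase j, bernProb ε (ℓ i)) *
        (if ℓ j then 1 else -1)) * Φ ℓ) ε :=
    HasDerivAt.fun_sum fun ℓ _ => by
      have := HasDerivAt.fun_finsetProd (u := univ) (f := fun i ε => bernProb ε (ℓ i))
        fun i _ => hasDerivAt_bernProb ε (ℓ i)
      exact this.mul_const _
  convert h1 using 1
  simp only [mul_sum, sum_mul]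
  rw [sum_comm, sum_comm (s := univ (α := Fin n → Bool))]
  refine sum_congr rfl fun j _ => ?_
  have hinv : Function.Involutive fun ℓ : Fin n → Bool => Function.update ℓ j (!ℓ j) := by
    intro ℓ
    simp
  have hflip : ∀ g : (Fin n → Bool) → ℝ,
      ∑ ℓ, g ℓ = (∑ ℓ, (g ℓ + g (Function.update ℓ j (!ℓ j)))) / 2 := fun g => by
    rw [sum_add_distrib, show ∑ ℓ, g (Function.update ℓ j (!ℓ j)) = ∑ ℓ, g ℓ from
      Equiv.sum_comp (hinv.toPerm _) g]
    ring
  rw [hflip, hflip fun ℓ => _ * Φ ℓ]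
  congr 1
  refine sum_congr rfl fun ℓ _ => ?_
  have hprod : ∀ b, ∏ i ∈ univ.erase j, bernProb ε (Function.update ℓ j b i) =
      ∏ i ∈ univ.erase j, bernProb ε (ℓ i) := fun b => prod_congr rfl fun i hi => by
    rw [Function.update_of_ne (ne_of_mem_erase hi)]
  have hw : ∀ ℓ : Fin n → Bool, bernWeight ε ℓ =
      bernProb ε (ℓ j) * ∏ i ∈ univ.erase j, bernProb ε (ℓ i) := fun ℓ =>
    (mul_prod_erase _ _ (mem_univ j)).symm
  have hself : Function.update ℓ j (ℓ j) = ℓ := Function.update_eq_self j ℓ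
  simp only [hw, hprod, Function.update_idem, Function.update_self]
  cases hj : ℓ j <;> rw [hj] at hself <;> simp [hself, bernProb] <;> ring

end russo

section pinning

variable {n : ℕ} {p : ℝ → ℝ} {S : Finset ℝ}

lemma intervalIntegral_covMean_le (hp : ∀ s, 0 ≤ p s) (hS : ∑ s ∈ S, p s = 1) (lam : ℝ) {K : ℝ}
    (hK : 0 < K) (hSK : ∀ s ∈ S, |s| ≤ K) {ε₀ : ℝ} (h0 : 0 ≤ ε₀) (h1 : ε₀ ≤ 1) :
    ∫ ε in (0 : ℝ)..ε₀, ∑ ℓ : Fin n → Bool, bernWeight ε ℓ * covMean lam p S ℓ ≤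
      (1 / n : ℝ) * K ^ 4 := by
  set Φ : (Fin n → Bool) → ℝ := fun ℓ => varMean lam p S ℓ
  set c : ℝ := (1 / n : ℝ) ^ 2 * K ^ 2 with hc
  have hcont : ∀ g : (Fin n → Bool) → ℝ, Continuous fun ε => ∑ ℓ, bernWeight ε ℓ * g ℓ :=
    fun g => continuous_finsetSum _ fun ℓ _ => (continuous_bernWeight ℓ).mul_const _
  have hF := intervalIntegral.integral_eq_sub_of_hasDerivAt (a := 0) (b := ε₀)
    (fun ε _ => hasDerivAt_sum_bernWeight Φ ε) ((hcont _).intervalIntegrable _ _)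
  have hnn : 0 ≤ ∑ ℓ, bernWeight ε₀ ℓ * Φ ℓ := sum_nonneg fun ℓ _ =>
    mul_nonneg (bernWeight_nonneg h0 h1 ℓ) (varMean_nonneg hp hS lam)
  have hle : ∑ ℓ, bernWeight 0 ℓ * Φ ℓ ≤ n * K ^ 2 := by
    refine (sum_le_sum fun ℓ _ => mul_le_mul_of_nonneg_left (varMean_le hp hS lam hSK)
      (bernWeight_nonneg le_rfl zero_le_one ℓ)).trans (le_of_eq ?_)
    rw [← sum_mul, sum_bernWeight, one_mul]
  calc _ ≤ ∫ ε in (0 : ℝ)..ε₀, -c * ∑ ℓ, bernWeight ε ℓ * ∑ j, (Φ (Function.update ℓ j true) -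
        Φ (Function.update ℓ j false)) := by
        refine intervalIntegral.integral_mono_on h0 ((hcont _).intervalIntegrable _ _)
          (((hcont _).const_mul _).intervalIntegrable _ _) fun ε hε => ?_
        rw [mul_sum]
        refine sum_le_sum fun ℓ _ => ?_
        refine (mul_le_mul_of_nonneg_left (covMean_le hp hS lam hK hSK)
          (bernWeight_nonneg hε.1 (hε.2.trans h1) ℓ)).trans (le_of_eq ?_)
        have : ∑ j, (Φ (Function.update ℓ j true) - Φ (Function.update ℓ j false)) =
            -∑ j, (Φ (Function.update ℓ j false) - Φ (Function.update ℓ j true)) := by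
          rw [← sum_neg_distrib]
          simp only [neg_sub]
        rw [this, hc]
        ring
    _ = c * (∑ ℓ, bernWeight 0 ℓ * Φ ℓ - ∑ ℓ, bernWeight ε₀ ℓ * Φ ℓ) := by
        rw [intervalIntegral.integral_const_mul, hF]
        ring
    _ ≤ c * (n * K ^ 2) := mul_le_mul_of_nonneg_left (by linarith) (by positivity)
    _ = _ := by
        rw [hc]
        rcases Nat.eq_zero_or_pos n with rfl | hn
        · simp
        · have : (n : ℝ) ≠ 0 := by positivity
          field_simp

end pinning

/-- Exchange of the first two factors of a triple product. -/
def prodLeftComm (α β γ : Type*) [MeasurableSpace α] [MeasurableSpace β] [MeasurableSpace γ] :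
    α × γ × β ≃ᵐ γ × α × β :=
  (MeasurableEquiv.prodAssoc.symm.trans
    (MeasurableEquiv.prodCongr MeasurableEquiv.prodComm (MeasurableEquiv.refl β))).trans
    MeasurableEquiv.prodAssoc

lemma measurePreserving_prodLeftComm {α β γ : Type*} [MeasurableSpace α] [MeasurableSpace β]
    [MeasurableSpace γ] (μ : Measure α) (ν : Measure β) (κ : Measure γ)
    [SFinite μ] [SFinite ν] [SFinite κ] :
    MeasurePreserving (prodLeftComm α β γ) (μ.prod (κ.prod ν)) (κ.prod (μ.prod ν)) :=
  (measurePreserving_prodAssoc κ μ ν).comp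
    ((Measure.measurePreserving_swap.prod (MeasurePreserving.id ν)).comp
      (measurePreserving_prodAssoc μ κ ν).symm)

section finiteSupport

variable {α β γ : Type*} [MeasurableSpace α] [MeasurableSingletonClass α] [MeasurableSpace β]
  [MeasurableSpace γ]

lemma eq_sum_smul_dirac {μ : Measure α} {T : Finset α} (hT : μ (↑T : Set α)ᶜ = 0) :
    μ = ∑ x ∈ T, μ {x} • Measure.dirac x := by
  ext s hs
  rw [← measure_inter_add_sdiff s T.measurableSet,
    measure_mono_null (Set.sdiff_subset_compl s ↑T) hT, add_zero, Measure.finsetSum_apply]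
  have h : s ∩ ↑T = ⋃ x ∈ T, s ∩ {x} := by ext; simp [and_comm]
  rw [h, measure_biUnion_finset
    (fun x _ y _ hxy => (Set.disjoint_singleton.2 hxy).mono Set.inter_subset_right
      Set.inter_subset_right) fun x _ => hs.inter (measurableSet_singleton x)]
  refine sum_congr rfl fun x _ => ?_
  by_cases hx : x ∈ s <;> simp [hx, hs]

lemma prod_eq_sum_smul_map {μ : Measure α} {ν : Measure β} [SFinite ν] {T : Finset α}
    (hT : μ (↑T : Set α)ᶜ = 0) : μ.prod ν = ∑ x ∈ T, μ {x} • ν.map (Prod.mk x) := by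
  ext s hs
  rw [Measure.prod_apply hs, eq_sum_smul_dirac hT, lintegral_finsetSum_measure,
    Measure.finsetSum_apply, ← eq_sum_smul_dirac hT]
  refine sum_congr rfl fun x _ => ?_
  rw [lintegral_smul_measure, lintegral_dirac, Measure.smul_apply,
    Measure.map_apply measurable_prodMk_left hs]

lemma integrable_prod_of_finset {μ : Measure α} [IsFiniteMeasure μ] {ν : Measure β} [SFinite ν]
    {T : Finset α} (hT : μ (↑T : Set α)ᶜ = 0) {f : α × β → ℝ}
    (hf : ∀ x ∈ T, Integrable (fun y => f (x, y)) ν) : Integrable f (μ.prod ν) := by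
  rw [prod_eq_sum_smul_map hT, integrable_finsetSum_measure]
  exact fun x hx => ((measurableEmbedding_prodMk_left x).integrable_map_iff.2
    (hf x hx)).smul_measure (measure_ne_top _ _)

lemma integral_prod_of_finset {μ : Measure α} [IsFiniteMeasure μ] {ν : Measure β} [SFinite ν]
    {T : Finset α} (hT : μ (↑T : Set α)ᶜ = 0) {f : α × β → ℝ}
    (hf : ∀ x ∈ T, Integrable (fun y => f (x, y)) ν) :
    ∫ q, f q ∂μ.prod ν = ∑ x ∈ T, μ.real {x} * ∫ y, f (x, y) ∂ν := by
  have h := integrable_prod_of_finset hT hf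
  rw [prod_eq_sum_smul_map hT, integrable_finsetSum_measure] at h
  rw [prod_eq_sum_smul_map hT, integral_finsetSum_measure h]
  refine sum_congr rfl fun x _ => ?_
  rw [integral_smul_measure, (measurableEmbedding_prodMk_left x).integral_map, smul_eq_mul,
    measureReal_def]

lemma integrable_prod_prod_of_finset {κ : Measure γ} [SFinite κ] {μ : Measure α}
    [IsFiniteMeasure μ] {ν : Measure β} [SFinite ν] {T : Finset α} (hT : μ (↑T : Set α)ᶜ = 0)
    {f : γ × α × β → ℝ}
    (hf : ∀ x ∈ T, Integrable (fun q : γ × β => f (q.1, x, q.2)) (κ.prod ν)) :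
    Integrable f (κ.prod (μ.prod ν)) :=
  ((measurePreserving_prodLeftComm μ ν κ).integrable_comp_emb
    (MeasurableEquiv.measurableEmbedding _)).1 (integrable_prod_of_finset hT hf)

lemma integral_prod_prod_of_finset {κ : Measure γ} [SFinite κ] {μ : Measure α} [IsFiniteMeasure μ]
    {ν : Measure β} [SFinite ν] {T : Finset α} (hT : μ (↑T : Set α)ᶜ = 0) {f : γ × α × β → ℝ}
    (hf : ∀ x ∈ T, Integrable (fun q : γ × β => f (q.1, x, q.2)) (κ.prod ν)) :
    ∫ q, f q ∂κ.prod (μ.prod ν) =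
      ∑ x ∈ T, μ.real {x} * ∫ q : γ × β, f (q.1, x, q.2) ∂κ.prod ν :=
  ((measurePreserving_prodLeftComm μ ν κ).integral_comp' f).symm.trans
    (integral_prod_of_finset hT hf)

end finiteSupport

lemma pi_compl_piFinset_eq_zero {α ι : Type*} [MeasurableSpace α] [Fintype ι]
    [DecidableEq ι] {μ : Measure α}
    [IsFiniteMeasure μ] {T : Finset α} (hT : μ (↑T : Set α)ᶜ = 0) :
    Measure.pi (fun _ : ι => μ) (↑(Fintype.piFinset fun _ : ι => T) : Set (ι → α))ᶜ = 0 := by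
  have h : (↑(Fintype.piFinset fun _ : ι => T) : Set (ι → α))ᶜ ⊆
      ⋃ i : ι, Function.eval i ⁻¹' (↑T : Set α)ᶜ := by
    intro x hx
    simpa [Fintype.mem_piFinset] using hx
  exact measure_mono_null h (measure_iUnion_null fun i => Measure.pi_eval_preimage_null _ hT)

lemma sum_piFinset_castSucc {α : Type*} [DecidableEq α] {n : ℕ} {T : Finset α} {c : α → ℝ}
    (hc : ∑ s ∈ T, c s = 1) (F : (Fin n → α) → ℝ) :
    ∑ x ∈ Fintype.piFinset (fun _ : Fin (n + 1) => T),
        (∏ i, c (x i)) * F (fun i => x i.castSucc) =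
      ∑ x ∈ Fintype.piFinset (fun _ : Fin n => T), (∏ i, c (x i)) * F x := by
  calc _ = ∑ q ∈ T ×ˢ Fintype.piFinset (fun _ : Fin n => T),
        c q.1 * ((∏ i, c (q.2 i)) * F q.2) := by
        refine sum_equiv (Fin.snocEquiv fun _ : Fin (n + 1) => α).symm (fun x => ?_) fun x _ => ?_
        · simp [Fintype.mem_piFinset, Fin.forall_fin_succ', Fin.init, and_comm]
        · simp only [Fin.snocEquiv_symm_apply, Fin.prod_univ_castSucc, Fin.init_def]
          ring
    _ = _ := by simp only [sum_product, ← mul_sum, ← sum_mul, hc, one_mul]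

lemma sum_real_singleton {P0 : Measure ℝ} [IsProbabilityMeasure P0] {S : Finset ℝ}
    (hsupp : P0 (↑S : Set ℝ)ᶜ = 0) : ∑ s ∈ S, (P0 {s}).toReal = 1 := by
  have h : P0.real (↑S : Set ℝ) = 1 := by
    rw [measureReal_def, (prob_compl_eq_zero_iff S.measurableSet).1 hsupp, ENNReal.toReal_one]
  rw [← h, ← sum_measureReal_singleton]
  rfl

lemma bern_real_singleton {ε : ℝ} (h0 : 0 ≤ ε) (h1 : ε ≤ 1) (b : Bool) :
    (bern ε {b}).toReal = bernProb ε b := by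
  cases b <;> simp [bern, bernProb, h0, h1]

lemma integral_cavMeas {P0 : Measure ℝ} [IsProbabilityMeasure P0] {S : Finset ℝ}
    (hsupp : P0 (↑S : Set ℝ)ᶜ = 0) {n : ℕ} {ε : ℝ} (h0 : 0 ≤ ε) (h1 : ε ≤ 1)
    {F : (Fin n → ℝ) → (Fin n → Bool) → (Fin (n + 1) × Fin (n + 1) → ℝ) ×
      ((Fin (n + 1) → ℝ) × (Fin (n + 1) × Fin (n + 1) → ℝ)) → ℝ}
    (hF : ∀ X ∈ confs S n, ∀ ℓ, Integrable (F X ℓ) ((disorder n).prod (stdGaussProd _ _))) :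
    ∫ ω, F (fun i => ω.1 i.castSucc) (fun i => ω.2.2.1 i.castSucc) (ω.2.1, ω.2.2.2)
        ∂cavMeas P0 n ε =
      ∑ ℓ : Fin n → Bool, bernWeight ε ℓ * ∑ X ∈ confs S n,
        prodWeight (fun s => (P0 {s}).toReal) X *
          ∫ Z, ∫ G, F X ℓ (Z, G) ∂stdGaussProd _ _ ∂disorder n := by
  have hX : ∀ X ∈ confs S (n + 1), (fun i : Fin n => X i.castSucc) ∈ confs S n := fun X hX => by
    simp only [confs, Fintype.mem_piFinset] at hX ⊢
    exact fun i => hX _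
  have hL : Measure.pi (fun _ : Fin (n + 1) => bern ε)
      (↑(Fintype.piFinset fun _ : Fin (n + 1) => (univ : Finset Bool)) :
        Set (Fin (n + 1) → Bool))ᶜ = 0 := by
    rw [Fintype.piFinset_univ]; simp
  have hsec : ∀ X ∈ confs S (n + 1),
      ∀ L ∈ Fintype.piFinset fun _ : Fin (n + 1) => (univ : Finset Bool),
      Integrable (fun q : (Fin (n + 1) × Fin (n + 1) → ℝ) × ((Fin (n + 1) → ℝ) ×
        (Fin (n + 1) × Fin (n + 1) → ℝ)) => F (fun i => X i.castSucc) (fun i => L i.castSucc)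
          (q.1, q.2)) ((disorder n).prod (stdGaussProd _ _)) := fun X h L _ => hF _ (hX X h) _
  have hP := pi_compl_piFinset_eq_zero (ι := Fin (n + 1)) hsupp
  have hcb : ∑ b ∈ (univ : Finset Bool), bernProb ε b = 1 := by simp [bernProb]
  rw [cavMeas, integral_prod_of_finset hP fun X h =>
    integrable_prod_prod_of_finset hL (hsec X h)]
  have hpi : ∀ X : Fin (n + 1) → ℝ, (Measure.pi fun _ : Fin (n + 1) => P0).real {X} =
      ∏ i, (P0 {X i}).toReal := fun X => by
    rw [measureReal_def, Measure.pi_singleton, ENNReal.toReal_prod]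
  have hpiL : ∀ L : Fin (n + 1) → Bool, (Measure.pi fun _ : Fin (n + 1) => bern ε).real {L} =
      ∏ i, bernProb ε (L i) := fun L => by
    simp_rw [measureReal_def, Measure.pi_singleton, ENNReal.toReal_prod,
      bern_real_singleton h0 h1]
  calc _ = ∑ X ∈ confs S (n + 1), (∏ i, (P0 {X i}).toReal) *
        ∑ L ∈ Fintype.piFinset fun _ : Fin (n + 1) => (univ : Finset Bool),
          (∏ i, bernProb ε (L i)) * ∫ q, F (fun i => X i.castSucc) (fun i => L i.castSucc) q
            ∂(disorder n).prod (stdGaussProd _ _) := by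
        refine sum_congr rfl fun X h => ?_
        rw [hpi, integral_prod_prod_of_finset hL (hsec X h)]
        simp_rw [hpiL]
    _ = ∑ X ∈ confs S n, prodWeight (fun s => (P0 {s}).toReal) X *
        ∑ ℓ : Fin n → Bool, bernWeight ε ℓ * ∫ q, F X ℓ q
            ∂(disorder n).prod (stdGaussProd _ _) := by
        rw [confs, sum_piFinset_castSucc (sum_real_singleton hsupp) fun X =>
          ∑ L ∈ Fintype.piFinset fun _ : Fin (n + 1) => (univ : Finset Bool),
          (∏ i, bernProb ε (L i)) * ∫ q, F X (fun i => L i.castSucc) q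
            ∂(disorder n).prod (stdGaussProd _ _)]
        refine sum_congr rfl fun X _ => ?_
        rw [sum_piFinset_castSucc hcb fun ℓ => ∫ q, F X ℓ q
            ∂(disorder n).prod (stdGaussProd _ _), Fintype.piFinset_univ]
        rfl
    _ = _ := by
        simp_rw [mul_sum]
        rw [sum_comm]
        refine sum_congr rfl fun ℓ _ => sum_congr rfl fun X h => ?_
        rw [integral_prod _ (hF X h ℓ)]
        ring

lemma integral_log_gibbs {P0 : Measure ℝ} [IsProbabilityMeasure P0] {S : Finset ℝ}
    (hsupp : P0 (↑S : Set ℝ)ᶜ = 0) {lam : ℝ} (hlam : 0 < lam) {n : ℕ} {ε : ℝ} (h0 : 0 ≤ ε)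
    (h1 : ε ≤ 1) :
    ∫ ω, Real.log (gibbs P0 S n lam ω fun x => Real.exp (yfield n lam ω x)) ∂cavMeas P0 n ε =
      ∑ ℓ : Fin n → Bool, bernWeight ε ℓ * fieldMean lam (fun s => (P0 {s}).toReal) S ℓ := by
  simp_rw [gibbs_eq_condAvg hlam, yfield_eq hlam]
  exact integral_cavMeas hsupp h0 h1 (F := fun X ℓ q => Real.log
      (condField lam (fun s => (P0 {s}).toReal) S (likelihood lam (q.1 + hVec lam X)) ℓ X q.2))
    fun X _ ℓ => integrable_log_condField (fun _ => ENNReal.toReal_nonneg)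
      (sum_real_singleton hsupp) lam _

lemma integral_sq_Qoverlap {P0 : Measure ℝ} [IsProbabilityMeasure P0] {S : Finset ℝ}
    (hsupp : P0 (↑S : Set ℝ)ᶜ = 0) {K : ℝ} (hSK : ∀ s ∈ S, |s| ≤ K) {lam : ℝ} (hlam : 0 < lam)
    {n : ℕ} {ε : ℝ} (h0 : 0 ≤ ε) (h1 : ε ≤ 1) :
    ∫ ω, Qoverlap P0 S n lam ω ^ 2 ∂cavMeas P0 n ε =
      ∑ ℓ : Fin n → Bool, bernWeight ε ℓ * overlapMean lam (fun s => (P0 {s}).toReal) S ℓ := by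
  simp_rw [Qoverlap_eq_ndot hlam]
  refine (integral_cavMeas hsupp h0 h1 (F := fun X ℓ q =>
      condOverlap (fun s => (P0 {s}).toReal) S (likelihood lam (q.1 + hVec lam X)) ℓ X ^ 2)
    fun X hX ℓ => ?_).trans ?_
  · refine (integrable_const ((K ^ 2) ^ 2)).mono' ?_ (Eventually.of_forall fun q => ?_)
    · exact (((measurable_condOverlap lam).comp
        (measurable_fst.add_const _)).pow_const 2).aestronglyMeasurable
    · rw [Real.norm_eq_abs, abs_pow]
      exact pow_le_pow_left₀ (abs_nonneg _) (abs_condOverlap_le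
        (fun _ => ENNReal.toReal_nonneg) (sum_real_singleton hsupp) (likelihood_pos lam _)
        hSK hX) 2
  · simp [overlapMean]

lemma exists_intervalIntegral_abs_sub_le {P0 : Measure ℝ} [IsProbabilityMeasure P0]
    {S : Finset ℝ} (hsupp : P0 (↑S : Set ℝ)ᶜ = 0) {K : ℝ} (hK : 0 < K)
    (hSK : ∀ s ∈ S, |s| ≤ K) {lam : ℝ} (hlam : 0 < lam) {ε₀ : ℝ} (h0 : 0 ≤ ε₀) (h1 : ε₀ ≤ 1)
    {η : ℝ} (hη : 0 < η) :
    ∃ C, 0 ≤ C ∧ ∀ n : ℕ, ∫ ε in (0 : ℝ)..ε₀,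
        |(∫ ω, Real.log (gibbs P0 S n lam ω (fun x => Real.exp (yfield n lam ω x)))
            ∂cavMeas P0 n ε)
          - lam / 4 * ∫ ω, (Qoverlap P0 S n lam ω) ^ 2 ∂cavMeas P0 n ε| ≤
      η + C * ((1 / n : ℝ) * K ^ 4) := by
  obtain ⟨C, hC, hb⟩ := exists_abs_fieldMean_sub_le hlam hK hη
  refine ⟨C, hC, fun n => ?_⟩
  set p : ℝ → ℝ := fun s => (P0 {s}).toReal with hpdef
  have hp : ∀ s, 0 ≤ p s := fun _ => ENNReal.toReal_nonneg
  have hS : ∑ s ∈ S, p s = 1 := sum_real_singleton hsupp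
  have hcont : ∀ c : (Fin n → Bool) → ℝ,
      Continuous fun ε => ∑ ℓ : Fin n → Bool, bernWeight ε ℓ * c ℓ := fun c =>
    continuous_finsetSum _ fun ℓ _ => (continuous_bernWeight ℓ).mul_const _
  calc _ = ∫ ε in (0 : ℝ)..ε₀, |∑ ℓ : Fin n → Bool, bernWeight ε ℓ *
        (fieldMean lam p S ℓ - lam / 4 * overlapMean lam p S ℓ)| := by
        refine intervalIntegral.integral_congr fun ε hε => ?_
        rw [Set.uIcc_of_le h0] at hε
        rw [integral_log_gibbs hsupp hlam hε.1 (hε.2.trans h1),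
          integral_sq_Qoverlap hsupp hSK hlam hε.1 (hε.2.trans h1), mul_sum, ← sum_sub_distrib]
        refine congrArg _ (sum_congr rfl fun ℓ _ => ?_)
        ring
    _ ≤ ∫ ε in (0 : ℝ)..ε₀, (η + C * ∑ ℓ : Fin n → Bool, bernWeight ε ℓ * covMean lam p S ℓ) := by
        refine intervalIntegral.integral_mono_on h0 ((hcont _).abs.intervalIntegrable _ _)
          (((hcont _).const_mul C).const_add η |>.intervalIntegrable _ _) fun ε hε => ?_
        have hw := bernWeight_nonneg (n := n) hε.1 (hε.2.trans h1)
        calc _ ≤ ∑ ℓ : Fin n → Bool, bernWeight ε ℓ * (η + C * covMean lam p S ℓ) := by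
              refine (abs_sum_le_sum_abs _ _).trans (sum_le_sum fun ℓ _ => ?_)
              rw [abs_mul, abs_of_nonneg (hw ℓ)]
              exact mul_le_mul_of_nonneg_left (hb n p S ℓ hp hS hSK) (hw ℓ)
          _ = _ := by
              simp_rw [mul_add, sum_add_distrib]
              rw [← sum_mul, sum_bernWeight, one_mul, mul_sum]
              exact congrArg _ (sum_congr rfl fun ℓ _ => by ring)
    _ = ε₀ * η + C * ∫ ε in (0 : ℝ)..ε₀,
        ∑ ℓ : Fin n → Bool, bernWeight ε ℓ * covMean lam p S ℓ := by
        rw [intervalIntegral.integral_add (by simp)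
          (((hcont _).const_mul C).intervalIntegrable _ _), intervalIntegral.integral_const_mul]
        simp
    _ ≤ _ := add_le_add (mul_le_of_le_one_left hη.le h1) (mul_le_mul_of_nonneg_left
        (intervalIntegral_covMean_le hp hS lam hK hSK h0 h1) hC)
/-- **Cavity estimate, second part**:
`∫_0^{ε₀} |E[log⟨exp(y(x))⟩_{n,ε}] − (λ/4) E[Q²]| dε → 0` as `n → ∞`. -/
theorem cavity_estimate_part2 (P0 : Measure ℝ) [IsProbabilityMeasure P0]
    (S : Finset ℝ) (K : ℝ) (hK : 0 < K) (hSK : ∀ x ∈ S, x ∈ Set.Icc (-K) K)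
    (hsupp : P0 ((↑S : Set ℝ)ᶜ) = 0) (lam : ℝ) (hlam : 0 < lam)
    (ε₀ : ℝ) (hε₀ : ε₀ ∈ Set.Ioc (0 : ℝ) 1) :
    Tendsto (fun n => ∫ ε in (0 : ℝ)..ε₀,
        |(∫ ω, Real.log (gibbs P0 S n lam ω (fun x => Real.exp (yfield n lam ω x)))
            ∂cavMeas P0 n ε)
          - lam / 4 * ∫ ω, (Qoverlap P0 S n lam ω) ^ 2 ∂cavMeas P0 n ε|)
      atTop (nhds 0) := by
  have hSK' : ∀ s ∈ S, |s| ≤ K := fun s hs => abs_le.2 (hSK s hs)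
  refine Metric.tendsto_atTop'.2 fun e he => ?_
  obtain ⟨C, hC, hb⟩ := exists_intervalIntegral_abs_sub_le hsupp hK hSK' hlam hε₀.1.le hε₀.2
    (half_pos he)
  have hlim : Tendsto (fun n : ℕ => e / 2 + C * ((1 / n : ℝ) * K ^ 4)) atTop (nhds (e / 2)) := by
    simpa using (((tendsto_one_div_atTop_nhds_zero_nat (𝕜 := ℝ)).mul_const (K ^ 4)).const_mul
      C).const_add (e / 2)
  obtain ⟨N, hN⟩ := eventually_atTop.1 (hlim.eventually_lt_const (half_lt_self he))
  refine ⟨N, fun n hn => ?_⟩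
  rw [Real.dist_eq, sub_zero, abs_of_nonneg
    (intervalIntegral.integral_nonneg hε₀.1.le fun _ _ => abs_nonneg _)]
  exact (hb n).trans_lt (hN n hn.le)

end
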